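/- arXiv:1810.10127 — 2 statements merged into one kernel-verified Lean document; each statement's English description precedes it below -/
import Mathlib

section
/- Let α = p/q − Σ_{j=2}^∞ (−1)^j/x_j. Then α is transcendental, and its irrationality exponent satisfies μ(α) ≥ (3 + √5)/2. -/
/-- The set of "good rational approximations" `P/Q` (with `Q ≥ 1`) to `α` for exponent `μ`:
pairs `(P, Q)` with `0 < |α - P/Q| < 1/Q^μ`.  The irrationality exponent of `α` is the
supremum of the set of `μ` for which this set is infinite. -/
def approxSet (α μ : ℝ) : Set (ℤ × ℤ) :=
  {PQ | 1 ≤ PQ.2 ∧ 0 < |α - (PQ.1 : ℝ) / (PQ.2 : ℝ)| ∧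
    |α - (PQ.1 : ℝ) / (PQ.2 : ℝ)| < 1 / (PQ.2 : ℝ) ^ μ}

namespace RothProof

open MvPolynomial

section Shift

variable {σ R S : Type*} [CommRing R] [CommRing S]

/-- The translation `P(X) ↦ P(X + r)`; the coefficients of the result are the normalised
derivatives of `P` at `r`. -/
noncomputable def shift (r : σ → R) : MvPolynomial σ R →ₐ[R] MvPolynomial σ R :=
  aeval fun i => X i + C (r i)

lemma shift_shift (r s : σ → R) (P : MvPolynomial σ R) :
    shift r (shift s P) = shift (r + s) P := by
  have : (shift r).comp (shift s) = shift (r + s) := by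
    refine algHom_ext fun i => ?_
    simp [shift, add_assoc]
  exact DFunLike.congr_fun this P

lemma shift_zero (P : MvPolynomial σ R) : shift (0 : σ → R) P = P := by
  simp [shift]

lemma shift_injective (r : σ → R) : Function.Injective (shift r) := by
  intro P Q h
  have := congrArg (shift (-r)) h
  simpa [shift_shift, shift_zero] using this

lemma map_shift (φ : R →+* S) (r : σ → R) (P : MvPolynomial σ R) :
    map φ (shift r P) = shift (fun i => φ (r i)) (map φ P) := by
  induction P using MvPolynomial.induction_on with
  | C a => simp [shift]
  | add p q hp hq => simp [hp, hq]
  | mul_X p i hp => rw [map_mul, map_mul, hp]; simp [shift]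

variable [Fintype σ]

/-- The product of the binomial coefficients of two exponents. -/
def multichoose (e μ : σ →₀ ℕ) : ℕ := ∏ i, (e i).choose (μ i)

lemma multichoose_eq_zero {e μ : σ →₀ ℕ} (h : ¬ μ ≤ e) : multichoose e μ = 0 := by
  rw [Finsupp.le_def] at h
  push Not at h
  obtain ⟨i, hi⟩ := h
  exact Finset.prod_eq_zero (Finset.mem_univ i) (Nat.choose_eq_zero_of_lt hi)

lemma multichoose_le (e μ : σ →₀ ℕ) (d : σ → ℕ) (h : ∀ i, e i ≤ d i) :
    multichoose e μ ≤ 2 ^ ∑ i, d i := by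
  rw [← Finset.prod_pow_eq_pow_sum]
  refine Finset.prod_le_prod' fun i _ => ?_
  exact (Nat.choose_le_two_pow _ _).trans (Nat.pow_le_pow_right (by norm_num) (h i))

lemma coeff_prod_X_add_C_pow (r : σ → R) (e' e : σ →₀ ℕ) :
    coeff e (∏ i, (X i + C (r i)) ^ e' i) = multichoose e' e * ∏ i, r i ^ (e' i - e i) := by
  classical
  have h1 : ∀ i : σ, ((X i + C (r i)) ^ e' i : MvPolynomial σ R) =
      ∑ k ∈ Finset.range (e' i + 1), monomial (Finsupp.single i k)
        (r i ^ (e' i - k) * ((e' i).choose k : R)) := by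
    intro i
    rw [add_pow]
    refine Finset.sum_congr rfl fun k _ => ?_
    rw [X_pow_eq_monomial, ← C_pow, ← map_natCast (C : R →+* MvPolynomial σ R), mul_assoc,
      ← C_mul, mul_comm, C_mul_monomial, mul_one]
  simp_rw [h1]
  rw [Finset.prod_univ_sum, coeff_sum]
  have h2 : ∀ x : σ → ℕ, (∏ i, monomial (Finsupp.single i (x i))
      (r i ^ (e' i - x i) * ((e' i).choose (x i) : R))) =
      monomial (Finsupp.equivFunOnFinite.symm x)
        (∏ i, (r i ^ (e' i - x i) * ((e' i).choose (x i) : R))) := by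
    intro x
    rw [← monomial_sum_prod]
    congr 2
    ext j
    simp [Finsupp.finsetSum_apply, Finsupp.single_apply]
  simp_rw [h2, coeff_monomial]
  by_cases hle : e ≤ e'
  · rw [Finset.sum_eq_single (e : σ → ℕ)]
    · rw [if_pos (by ext; simp)]
      simp only [multichoose, Finset.prod_mul_distrib]
      push_cast
      ring
    · intro b _ hb
      rw [if_neg]
      rintro rfl
      exact hb (by ext; simp)
    · intro h
      exact absurd (Fintype.mem_piFinset.2 fun i =>
        Finset.mem_range.2 (Nat.lt_succ_of_le (hle i))) h
  · rw [multichoose_eq_zero hle, Nat.cast_zero, zero_mul]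
    refine Finset.sum_eq_zero fun x hx => if_neg ?_
    rintro rfl
    refine hle fun i => ?_
    have := Finset.mem_range.1 (Fintype.mem_piFinset.1 hx i)
    simpa using Nat.le_of_lt_succ this

lemma coeff_shift_monomial (r : σ → R) (e' e : σ →₀ ℕ) (c : R) :
    coeff e (shift r (monomial e' c)) =
      c * (multichoose e' e * ∏ i, r i ^ (e' i - e i)) := by
  rw [shift, aeval_monomial, algebraMap_eq, coeff_C_mul, Finsupp.prod_fintype _ _ (by simp),
    coeff_prod_X_add_C_pow]

lemma coeff_shift (r : σ → R) (P : MvPolynomial σ R) (e : σ →₀ ℕ) :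
    coeff e (shift r P) = ∑ e' ∈ P.support,
      coeff e' P * (multichoose e' e * ∏ i, r i ^ (e' i - e i)) := by
  conv_lhs => rw [P.as_sum, map_sum, coeff_sum]
  exact Finset.sum_congr rfl fun e' _ => coeff_shift_monomial _ _ _ _

/-- The normalised partial derivative `∂^μ / μ!`. -/
noncomputable def hasse (μ : σ →₀ ℕ) (P : MvPolynomial σ R) : MvPolynomial σ R :=
  ∑ e ∈ P.support, monomial (e - μ) (multichoose e μ * coeff e P)

lemma coeff_hasse (μ : σ →₀ ℕ) (P : MvPolynomial σ R) (e : σ →₀ ℕ) :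
    coeff e (hasse μ P) = multichoose (e + μ) μ * coeff (e + μ) P := by
  classical
  rw [hasse, coeff_sum]
  simp_rw [coeff_monomial]
  rw [Finset.sum_eq_single (e + μ)]
  · rw [if_pos (by simp)]
  · intro b _ hb
    split_ifs with h
    · rw [multichoose_eq_zero, Nat.cast_zero, zero_mul]
      intro hle
      exact hb (by rw [← h, tsub_add_cancel_of_le hle])
    · rfl
  · intro h
    rw [notMem_support_iff.1 h]
    simp

lemma hasse_add (μ : σ →₀ ℕ) (P Q : MvPolynomial σ R) :
    hasse μ (P + Q) = hasse μ P + hasse μ Q := by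
  ext e
  simp [coeff_hasse, mul_add]

/-- `hasse` as an additive map. -/
noncomputable def hasseHom (μ : σ →₀ ℕ) : MvPolynomial σ R →+ MvPolynomial σ R where
  toFun := hasse μ
  map_zero' := by ext; simp [coeff_hasse]
  map_add' := hasse_add μ

lemma hasse_sum {ι : Type*} (μ : σ →₀ ℕ) (s : Finset ι) (f : ι → MvPolynomial σ R) :
    hasse μ (∑ i ∈ s, f i) = ∑ i ∈ s, hasse μ (f i) :=
  map_sum (hasseHom μ) f s

lemma map_hasse (φ : R →+* S) (μ : σ →₀ ℕ) (P : MvPolynomial σ R) :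
    map φ (hasse μ P) = hasse μ (map φ P) := by
  ext e
  simp [coeff_map, coeff_hasse]

lemma multichoose_mul_multichoose (e' e μ : σ →₀ ℕ) :
    multichoose (e + μ) μ * multichoose e' (e + μ) =
      multichoose e' μ * multichoose (e' - μ) e := by
  by_cases h : e + μ ≤ e'
  · simp only [multichoose, ← Finset.prod_mul_distrib]
    refine Finset.prod_congr rfl fun i _ => ?_
    have := Nat.choose_mul (n := e' i) (k := e i + μ i) (s := μ i) (Nat.le_add_left _ _)
    simp only [Finsupp.add_apply, Finsupp.tsub_apply]
    rw [mul_comm, this, Nat.add_sub_cancel]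
  · rw [multichoose_eq_zero h, mul_zero]
    by_cases h2 : μ ≤ e'
    · rw [multichoose_eq_zero (e := e' - μ), mul_zero]
      intro h3
      exact h ((add_le_add_left h3 μ).trans_eq (tsub_add_cancel_of_le h2))
    · rw [multichoose_eq_zero h2, zero_mul]

lemma hasse_monomial (μ e : σ →₀ ℕ) (c : R) :
    hasse μ (monomial e c) = monomial (e - μ) (multichoose e μ * c) := by
  classical
  ext f
  rw [coeff_hasse, coeff_monomial, coeff_monomial]
  by_cases h : e = f + μ
  · subst h; simp
  · rw [if_neg h, mul_zero]
    split_ifs with h2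
    · rw [multichoose_eq_zero, Nat.cast_zero, zero_mul]
      intro hle
      exact h (by rw [← h2, tsub_add_cancel_of_le hle])
    · rfl

lemma shift_hasse (r : σ → R) (μ : σ →₀ ℕ) (P : MvPolynomial σ R) :
    shift r (hasse μ P) = hasse μ (shift r P) := by
  induction P using MvPolynomial.induction_on' with
  | add p q hp hq => rw [hasse_add, map_add, map_add, hasse_add, hp, hq]
  | monomial u c =>
    ext e
    rw [hasse_monomial, coeff_shift_monomial, coeff_hasse, coeff_shift_monomial]
    have h := congrArg (Nat.cast (R := R)) (multichoose_mul_multichoose u e μ)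
    push_cast at h
    have h2 : ∏ i, r i ^ ((u - μ) i - e i) = ∏ i, r i ^ (u i - (e + μ) i) :=
      Finset.prod_congr rfl fun i _ => by
        simp only [Finsupp.add_apply, Finsupp.tsub_apply]
        congr 1
        omega
    rw [h2]
    linear_combination (-(c * ∏ i, r i ^ (u i - (e + μ) i))) * h

end Shift

section Index

variable {σ R : Type*} [Fintype σ] [CommRing R]

/-- The weighted degree of an exponent. -/
def wt (w : σ → ℝ) (e : σ →₀ ℕ) : ℝ := ∑ i, w i * e i

lemma wt_add (w : σ → ℝ) (e f : σ →₀ ℕ) : wt w (e + f) = wt w e + wt w f := by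
  simp [wt, mul_add, Finset.sum_add_distrib]

lemma wt_nonneg {w : σ → ℝ} (hw : ∀ i, 0 ≤ w i) (e : σ →₀ ℕ) : 0 ≤ wt w e :=
  Finset.sum_nonneg fun i _ => mul_nonneg (hw i) (Nat.cast_nonneg _)

/-- All monomials of `P` have weight at least `θ`. -/
def IndexGE (w : σ → ℝ) (θ : ℝ) (P : MvPolynomial σ R) : Prop :=
  ∀ e, coeff e P ≠ 0 → θ ≤ wt w e

lemma IndexGE.mul {w : σ → ℝ} {θ θ' : ℝ} {P Q : MvPolynomial σ R} (hP : IndexGE w θ P)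
    (hQ : IndexGE w θ' Q) : IndexGE w (θ + θ') (P * Q) := by
  classical
  intro e he
  rw [coeff_mul] at he
  obtain ⟨x, hx, hne⟩ := Finset.exists_ne_zero_of_sum_ne_zero he
  rw [← Finset.HasAntidiagonal.mem_antidiagonal.1 hx, wt_add]
  exact add_le_add (hP _ (left_ne_zero_of_mul hne)) (hQ _ (right_ne_zero_of_mul hne))

lemma IndexGE.prod {w : σ → ℝ} {ι : Type*} (s : Finset ι) (θ : ι → ℝ)
    (P : ι → MvPolynomial σ R) (hP : ∀ i ∈ s, IndexGE w (θ i) (P i)) :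
    IndexGE w (∑ i ∈ s, θ i) (∏ i ∈ s, P i) := by
  classical
  induction s using Finset.induction_on with
  | empty =>
    intro e he
    have : e = 0 := by
      by_contra h
      rw [Finset.prod_empty, coeff_one, if_neg (Ne.symm h)] at he
      exact he rfl
    simp [this, wt]
  | insert a s ha ih =>
    rw [Finset.sum_insert ha, Finset.prod_insert ha]
    exact (hP a (Finset.mem_insert_self _ _)).mul
      (ih fun i hi => hP i (Finset.mem_insert_of_mem hi))

lemma IndexGE.det {w : σ → ℝ} {N : ℕ} (θ : Fin N → ℝ)
    (M : Matrix (Fin N) (Fin N) (MvPolynomial σ R)) (hM : ∀ i l, IndexGE w (θ l) (M i l)) :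
    IndexGE w (∑ l, θ l) M.det := by
  intro e he
  rw [Matrix.det_apply, coeff_sum] at he
  obtain ⟨τ, -, hτ⟩ := Finset.exists_ne_zero_of_sum_ne_zero he
  refine IndexGE.prod Finset.univ θ (fun i => M (τ i) i) (fun i _ => hM _ _) e fun h0 => hτ ?_
  rw [Units.smul_def, coeff_smul, h0, smul_zero]

lemma IndexGE.hasse {w : σ → ℝ} {θ : ℝ} {P : MvPolynomial σ R} (hP : IndexGE w θ P)
    (μ : σ →₀ ℕ) : IndexGE w (θ - wt w μ) (hasse μ P) := by
  intro e he
  rw [coeff_hasse] at he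
  have := hP _ (right_ne_zero_of_mul he)
  rw [wt_add] at this
  linarith

end Index

section L1

variable {σ R : Type*} [NormedCommRing R]

/-- The sum of the norms of the coefficients. -/
noncomputable def l1 (P : MvPolynomial σ R) : ℝ := ∑ e ∈ P.support, ‖coeff e P‖

lemma l1_eq_sum {P : MvPolynomial σ R} {T : Finset (σ →₀ ℕ)} (h : P.support ⊆ T) :
    l1 P = ∑ e ∈ T, ‖coeff e P‖ :=
  Finset.sum_subset h fun e _ he => by rw [notMem_support_iff.1 he, norm_zero]

lemma l1_nonneg (P : MvPolynomial σ R) : 0 ≤ l1 P :=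
  Finset.sum_nonneg fun _ _ => norm_nonneg _

lemma norm_coeff_le_l1 (P : MvPolynomial σ R) (e : σ →₀ ℕ) : ‖coeff e P‖ ≤ l1 P := by
  by_cases h : e ∈ P.support
  · exact Finset.single_le_sum (f := fun e => ‖coeff e P‖) (fun _ _ => norm_nonneg _) h
  · rw [notMem_support_iff.1 h, norm_zero]
    exact l1_nonneg P

lemma l1_zero : l1 (0 : MvPolynomial σ R) = 0 := by simp [l1]

lemma l1_add_le (P Q : MvPolynomial σ R) : l1 (P + Q) ≤ l1 P + l1 Q := by
  classical
  have h1 : P.support ⊆ P.support ∪ Q.support := Finset.subset_union_left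
  have h2 : Q.support ⊆ P.support ∪ Q.support := Finset.subset_union_right
  rw [l1_eq_sum h1, l1_eq_sum h2, l1_eq_sum (support_add (p := P) (q := Q)),
    ← Finset.sum_add_distrib]
  exact Finset.sum_le_sum fun e _ => by rw [coeff_add]; exact norm_add_le _ _

lemma l1_sum_le {ι : Type*} (s : Finset ι) (P : ι → MvPolynomial σ R) :
    l1 (∑ i ∈ s, P i) ≤ ∑ i ∈ s, l1 (P i) := by
  classical
  induction s using Finset.induction_on with
  | empty => simp [l1_zero]
  | insert a s ha ih =>
    rw [Finset.sum_insert ha, Finset.sum_insert ha]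
    exact (l1_add_le _ _).trans (by linarith)

lemma l1_monomial (e : σ →₀ ℕ) (c : R) : l1 (monomial e c) = ‖c‖ := by
  classical
  rw [l1_eq_sum (support_monomial_subset (s := e) (a := c))]
  simp

lemma l1_neg (P : MvPolynomial σ R) : l1 (-P) = l1 P := by
  simp [l1]

lemma l1_mul_le (P Q : MvPolynomial σ R) : l1 (P * Q) ≤ l1 P * l1 Q := by
  classical
  conv_lhs => rw [P.as_sum, Q.as_sum, Finset.sum_mul_sum]
  refine (l1_sum_le _ _).trans ?_
  rw [l1, l1, Finset.sum_mul_sum]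
  refine Finset.sum_le_sum fun e _ => (l1_sum_le _ _).trans (Finset.sum_le_sum fun f _ => ?_)
  rw [monomial_mul, l1_monomial]
  exact norm_mul_le _ _

variable [NormOneClass R]

lemma l1_one : l1 (1 : MvPolynomial σ R) = 1 := by
  rw [← C_1, C_apply, l1_monomial, norm_one]

lemma l1_prod_le {ι : Type*} (s : Finset ι) (P : ι → MvPolynomial σ R) :
    l1 (∏ i ∈ s, P i) ≤ ∏ i ∈ s, l1 (P i) := by
  classical
  induction s using Finset.induction_on with
  | empty => simp [l1_one]
  | insert a s ha ih =>
    rw [Finset.prod_insert ha, Finset.prod_insert ha]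
    exact (l1_mul_le _ _).trans (mul_le_mul_of_nonneg_left ih (l1_nonneg _))

lemma l1_pow_le (P : MvPolynomial σ R) (n : ℕ) : l1 (P ^ n) ≤ l1 P ^ n := by
  simpa using l1_prod_le (Finset.range n) fun _ => P

lemma l1_det_le {N : ℕ} (M : Matrix (Fin N) (Fin N) (MvPolynomial σ R)) (B : ℝ)
    (hM : ∀ i j, l1 (M i j) ≤ B) : l1 M.det ≤ N.factorial * B ^ N := by
  rw [Matrix.det_apply]
  refine (l1_sum_le _ _).trans ?_
  have h : ∀ τ : Equiv.Perm (Fin N),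
      l1 (Equiv.Perm.sign τ • ∏ i, M (τ i) i) ≤ B ^ N := by
    intro τ
    have h1 : l1 (Equiv.Perm.sign τ • ∏ i, M (τ i) i) = l1 (∏ i, M (τ i) i) := by
      rcases Int.units_eq_one_or (Equiv.Perm.sign τ) with h | h
      · simp [h]
      · simp [h, l1_neg]
    rw [h1]
    refine (l1_prod_le _ _).trans ?_
    calc ∏ i, l1 (M (τ i) i) ≤ ∏ _i : Fin N, B :=
          Finset.prod_le_prod (fun _ _ => l1_nonneg _) fun _ _ => hM _ _
      _ = B ^ N := by simp
  refine (Finset.sum_le_sum fun τ _ => h τ).trans ?_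
  simp [Fintype.card_perm]

lemma l1_hasse_le [Fintype σ] (μ : σ →₀ ℕ) (P : MvPolynomial σ R) (d : σ → ℕ)
    (hd : ∀ i, degreeOf i P ≤ d i) : l1 (hasse μ P) ≤ 2 ^ (∑ i, d i) * l1 P := by
  rw [hasse]
  refine (l1_sum_le _ _).trans ?_
  rw [l1, Finset.mul_sum]
  refine Finset.sum_le_sum fun e he => ?_
  rw [l1_monomial]
  refine (norm_mul_le _ _).trans (mul_le_mul_of_nonneg_right ?_ (norm_nonneg _))
  refine (Nat.norm_cast_le _).trans ?_
  rw [norm_one, mul_one]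
  exact_mod_cast multichoose_le e μ d fun i => (monomial_le_degreeOf i he).trans (hd i)

lemma l1_shift_le [Fintype σ] (r : σ → R) (P : MvPolynomial σ R) (d : σ → ℕ)
    (hd : ∀ i, degreeOf i P ≤ d i) (A : ℝ) (hA : ∀ i, 1 + ‖r i‖ ≤ A) :
    l1 (shift r P) ≤ A ^ (∑ i, d i) * l1 P := by
  conv_lhs => rw [P.as_sum, map_sum]
  refine (l1_sum_le _ _).trans ?_
  rw [l1, Finset.mul_sum]
  refine Finset.sum_le_sum fun e he => ?_
  rw [shift, aeval_monomial, algebraMap_eq, Finsupp.prod_fintype _ _ (by simp), mul_comm]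
  refine (l1_mul_le _ _).trans ?_
  rw [C_apply, l1_monomial]
  refine mul_le_mul_of_nonneg_right ?_ (norm_nonneg _)
  refine (l1_prod_le _ _).trans ?_
  rw [← Finset.prod_pow_eq_pow_sum]
  refine Finset.prod_le_prod (fun _ _ => l1_nonneg _) fun i _ => ?_
  have h1 : l1 (X i + C (r i) : MvPolynomial σ R) ≤ A := by
    refine (l1_add_le _ _).trans ?_
    rw [C_apply, l1_monomial, X, l1_monomial, norm_one]
    exact hA i
  have hA1 : 1 ≤ A := (le_add_of_nonneg_right (norm_nonneg _)).trans (hA i)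
  calc l1 ((X i + C (r i) : MvPolynomial σ R) ^ e i) ≤ l1 (X i + C (r i)) ^ e i := l1_pow_le _ _
    _ ≤ A ^ e i := pow_le_pow_left₀ (l1_nonneg _) h1 _
    _ ≤ A ^ d i := pow_le_pow_right₀ hA1 ((monomial_le_degreeOf i he).trans (hd i))

end L1

section Interpolation

variable {σ : Type*} [Fintype σ]

lemma mul_multichoose (e μ : σ →₀ ℕ) (i : σ) :
    (e i : ℚ) * multichoose e μ =
      (μ i + 1) * multichoose e (μ + Finsupp.single i 1) + μ i * multichoose e μ := by
  classical
  have h1 : multichoose e μ = (e i).choose (μ i) * ∏ j ∈ Finset.univ.erase i,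
      (e j).choose (μ j) :=
    (Finset.mul_prod_erase Finset.univ (fun j => (e j).choose (μ j)) (Finset.mem_univ i)).symm
  have h2 : multichoose e (μ + Finsupp.single i 1) =
      (e i).choose (μ i + 1) * ∏ j ∈ Finset.univ.erase i, (e j).choose (μ j) := by
    rw [multichoose, ← Finset.mul_prod_erase Finset.univ _ (Finset.mem_univ i)]
    congr 1
    · simp
    · refine Finset.prod_congr rfl fun j hj => ?_
      simp [(Finset.ne_of_mem_erase hj).symm]
  have h3 : ((e i).choose (μ i + 1) : ℚ) * (μ i + 1) = (e i).choose (μ i) * (e i - μ i) := by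
    rcases le_or_gt (μ i) (e i) with h | h
    · have := congrArg (Nat.cast (R := ℚ)) (Nat.choose_succ_right_eq (e i) (μ i))
      push_cast [Nat.cast_sub h] at this
      exact this
    · rw [Nat.choose_eq_zero_of_lt h, Nat.choose_eq_zero_of_lt (by omega)]
      simp
  rw [h1, h2]
  push_cast
  linear_combination (-(∏ j ∈ Finset.univ.erase i, ((e j).choose (μ j) : ℚ))) * h3

/-- The functions on exponents spanned by binomial products of degree at most `k`. -/
def binomialSpan (σ : Type*) [Fintype σ] (k : ℕ) : Submodule ℚ ((σ →₀ ℕ) → ℚ) :=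
  Submodule.span ℚ ((fun μ e => (multichoose e μ : ℚ)) '' {μ : σ →₀ ℕ | μ.degree ≤ k})

lemma binomialSpan_mono {k l : ℕ} (h : k ≤ l) : binomialSpan σ k ≤ binomialSpan σ l :=
  Submodule.span_mono (Set.image_mono fun _ hμ => le_trans hμ h)

lemma coordinate_mul_mem {k : ℕ} {φ : (σ →₀ ℕ) → ℚ} (hφ : φ ∈ binomialSpan σ k) (i : σ) :
    (fun e => (e i : ℚ) * φ e) ∈ binomialSpan σ (k + 1) := by
  induction hφ using Submodule.span_induction with
  | mem φ h =>
    obtain ⟨μ, hμ, rfl⟩ := h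
    have : (fun e : σ →₀ ℕ => (e i : ℚ) * (multichoose e μ : ℚ)) =
        ((μ i : ℚ) + 1) • (fun e => (multichoose e (μ + Finsupp.single i 1) : ℚ)) +
          (μ i : ℚ) • (fun e => (multichoose e μ : ℚ)) := by
      ext e
      simp [mul_multichoose]
    rw [this]
    refine Submodule.add_mem _ (Submodule.smul_mem _ _ (Submodule.subset_span ⟨_, ?_, rfl⟩))
      (Submodule.smul_mem _ _ (Submodule.subset_span ⟨_, ?_, rfl⟩))
    · simpa using hμ
    · exact le_trans hμ (Nat.le_succ k)
  | zero =>
    convert Submodule.zero_mem (binomialSpan σ (k + 1)) using 1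
    ext e
    simp
  | add x y _ _ hx hy =>
    convert Submodule.add_mem _ hx hy using 1
    ext e
    simp [mul_add]
  | smul a x _ hx =>
    convert Submodule.smul_mem _ a hx using 1
    ext e
    simp
    ring

lemma prod_affine_mem {ι : Type*} (s : Finset ι) (i : ι → σ) (c : ι → ℚ) :
    (fun e : σ →₀ ℕ => ∏ k ∈ s, ((e (i k) : ℚ) - c k)) ∈ binomialSpan σ s.card := by
  classical
  induction s using Finset.induction_on with
  | empty =>
    refine Submodule.subset_span ⟨0, by simp, ?_⟩
    ext e
    simp [multichoose]
  | insert a s ha ih =>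
    rw [Finset.card_insert_of_notMem ha]
    simp_rw [Finset.prod_insert ha]
    convert Submodule.sub_mem _ (coordinate_mul_mem ih (i a))
      (Submodule.smul_mem _ (c a) (binomialSpan_mono (Nat.le_succ _) ih)) using 1
    ext e
    simp [sub_mul]

lemma exists_multichoose_det_ne_zero {N : ℕ} (e : Fin N → (σ →₀ ℕ))
    (he : Function.Injective e) :
    ∃ μ : Fin N → (σ →₀ ℕ), (∀ i, (μ i).degree < N) ∧
      (Matrix.of fun i j => (multichoose (e j) (μ i) : ℚ)).det ≠ 0 := by
  classical
  let v : {μ : σ →₀ ℕ // μ.degree ≤ N - 1} → (Fin N → ℚ) :=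
    fun μ j => (multichoose (e j) μ.1 : ℚ)
  let ev : ((σ →₀ ℕ) → ℚ) →ₗ[ℚ] (Fin N → ℚ) := LinearMap.funLeft ℚ ℚ e
  have hmap : (binomialSpan σ (N - 1)).map ev = Submodule.span ℚ (Set.range v) := by
    rw [binomialSpan, Submodule.map_span, ← Set.image_comp]
    congr 1
    ext x
    constructor
    · rintro ⟨μ, hμ, rfl⟩
      exact ⟨⟨μ, hμ⟩, rfl⟩
    · rintro ⟨μ, rfl⟩
      exact ⟨μ.1, μ.2, rfl⟩
  have hspan : Submodule.span ℚ (Set.range v) = ⊤ := by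
    rw [← hmap, eq_top_iff, ← (Pi.basisFun ℚ (Fin N)).span_eq, Submodule.span_le]
    rintro _ ⟨j, rfl⟩
    have hsep : ∀ k : {k : Fin N // k ≠ j}, ∃ i : σ, e j i ≠ e k i := fun k =>
      Finsupp.ne_iff.1 fun h => k.2 (he h).symm
    choose i hi using hsep
    have hmem := prod_affine_mem Finset.univ i fun k => (e k (i k) : ℚ)
    rw [Finset.card_univ, Fintype.card_subtype_compl, Fintype.card_fin,
      Fintype.card_subtype_eq] at hmem
    set c : ℚ := ∏ k : {k : Fin N // k ≠ j}, ((e j (i k) : ℚ) - e k (i k)) with hc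
    have hc0 : c ≠ 0 := Finset.prod_ne_zero_iff.2 fun k _ => by
      rw [sub_ne_zero]
      exact_mod_cast hi k
    refine ⟨_, Submodule.smul_mem _ c⁻¹ hmem, ?_⟩
    ext l
    simp only [Pi.smul_apply, Pi.basisFun_apply, smul_eq_mul, ev,
      LinearMap.funLeft_apply]
    by_cases hl : l = j
    · subst hl
      rw [← hc, inv_mul_cancel₀ hc0, Pi.single_eq_same]
    · rw [Pi.single_eq_of_ne hl, Finset.prod_eq_zero (Finset.mem_univ ⟨l, hl⟩) (by simp), mul_zero]
  obtain ⟨κ, a, -, hspan', hli⟩ := exists_linearIndependent' ℚ v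
  rw [hspan] at hspan'
  let b := Module.Basis.mk hli hspan'.ge
  let φ : κ ≃ Fin N := b.indexEquiv (Pi.basisFun ℚ (Fin N))
  refine ⟨fun i => (a (φ.symm i)).1, fun i => ?_, ?_⟩
  · have := (a (φ.symm i)).2
    have := i.pos
    show (a (φ.symm i)).1.degree < N
    omega
  · have hli' : LinearIndependent ℚ
        (Matrix.of fun i j => (multichoose (e j) (a (φ.symm i)).1 : ℚ)).row :=
      hli.comp φ.symm φ.symm.injective
    rw [Matrix.linearIndependent_rows_iff_isUnit, Matrix.isUnit_iff_isUnit_det] at hli'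
    exact hli'.ne_zero

end Interpolation

section Wronskian

variable {n : ℕ}

lemma coeff_prod_of_degree_le (m : MonomialOrder (Fin n)) {ι : Type*} (s : Finset ι)
    (P : ι → MvPolynomial (Fin n) ℚ) (e : ι → (Fin n →₀ ℕ))
    (h : ∀ i ∈ s, m.toSyn (m.degree (P i)) ≤ m.toSyn (e i)) :
    coeff (∑ i ∈ s, e i) (∏ i ∈ s, P i) = ∏ i ∈ s, coeff (e i) (P i) := by
  classical
  induction s using Finset.induction_on with
  | empty => simp
  | insert a s ha ih =>
    have hs : ∀ i ∈ s, m.toSyn (m.degree (P i)) ≤ m.toSyn (e i) :=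
      fun i hi => h i (Finset.mem_insert_of_mem hi)
    simp only [Finset.sum_insert ha, Finset.prod_insert ha]
    rw [MonomialOrder.coeff_mul_of_add_of_degree_le (m := m) (h a (Finset.mem_insert_self _ _)),
      ih hs]
    refine m.degree_prod_le.trans ?_
    simp only [map_sum]
    exact Finset.sum_le_sum hs

lemma coeff_monomial_mul_hasse (μ e : Fin n →₀ ℕ) (P : MvPolynomial (Fin n) ℚ) :
    coeff e (monomial μ 1 * hasse μ P) = multichoose e μ * coeff e P := by
  rw [coeff_monomial_mul']
  split_ifs with h
  · rw [coeff_hasse, tsub_add_cancel_of_le h, one_mul]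
  · rw [multichoose_eq_zero h, Nat.cast_zero, zero_mul]

lemma exists_distinct_degrees (m : MonomialOrder (Fin n)) {N : ℕ}
    (f : Fin N → MvPolynomial (Fin n) ℚ) (hf : LinearIndependent ℚ f) :
    ∃ g : Fin N → MvPolynomial (Fin n) ℚ, (∀ j, g j ∈ Submodule.span ℚ (Set.range f)) ∧
      (∀ j, g j ≠ 0) ∧ Function.Injective fun j => m.degree (g j) := by
  classical
  set F := Submodule.span ℚ (Set.range f)
  set L : Set (Fin n →₀ ℕ) := {e | ∃ g ∈ F, g ≠ 0 ∧ m.degree g = e}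
  have hcard : ∃ t : Finset (Fin n →₀ ℕ), (t : Set _) ⊆ L ∧ t.card = N := by
    by_cases hL : L.Infinite
    · exact hL.exists_subset_card_eq N
    rw [Set.not_infinite] at hL
    by_contra hne
    have hlt : hL.toFinset.card < N := by
      by_contra hge
      obtain ⟨t, ht, htc⟩ := Finset.exists_subset_card_eq (not_lt.1 hge)
      exact hne ⟨t, fun x hx => hL.mem_toFinset.1 (ht hx), htc⟩
    let T : F →ₗ[ℚ] (hL.toFinset → ℚ) :=
      { toFun := fun g e => coeff e.1 g.1
        map_add' := fun _ _ => by ext; simp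
        map_smul' := fun _ _ => by ext; simp }
    have hF : Module.finrank ℚ F = N := by
      simpa using finrank_span_eq_card hf
    have : FiniteDimensional ℚ F := FiniteDimensional.span_of_finite ℚ (Set.finite_range f)
    have hker : LinearMap.ker T ≠ ⊥ := by
      refine LinearMap.ker_ne_bot_of_finrank_lt ?_
      rw [hF]
      simpa using hlt
    obtain ⟨g, hg, hg0⟩ := Submodule.exists_mem_ne_zero_of_ne_bot hker
    have hg0' : (g : MvPolynomial (Fin n) ℚ) ≠ 0 := fun h => hg0 (Subtype.ext h)
    have hmem : m.degree (g : MvPolynomial (Fin n) ℚ) ∈ hL.toFinset :=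
      hL.mem_toFinset.2 ⟨g, g.2, hg0', rfl⟩
    have h0 := congrFun (LinearMap.mem_ker.1 hg) ⟨_, hmem⟩
    exact m.coeff_degree_ne_zero_iff.2 hg0' h0
  obtain ⟨t, ht, htc⟩ := hcard
  let φ : Fin N ≃ t := (t.equivFinOfCardEq htc).symm
  choose g hgF hg0 hgd using fun j => ht (φ j).2
  refine ⟨g, hgF, hg0, fun i j hij => ?_⟩
  simp only [hgd] at hij
  exact φ.injective (Subtype.ext hij)

theorem exists_hasse_det_ne_zero {N : ℕ} (f : Fin N → MvPolynomial (Fin n) ℚ)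
    (hf : LinearIndependent ℚ f) :
    ∃ μ : Fin N → (Fin n →₀ ℕ), (∀ i, (μ i).degree < N) ∧
      (Matrix.of fun i j => hasse (μ i) (f j)).det ≠ 0 := by
  classical
  let m : MonomialOrder (Fin n) := MonomialOrder.lex
  obtain ⟨g, hgF, hg0, hinj⟩ := exists_distinct_degrees m f hf
  obtain ⟨μ, hμ, hdet⟩ := exists_multichoose_det_ne_zero _ hinj
  refine ⟨μ, hμ, fun h0 => ?_⟩
  have hA : ∀ j, ∃ A : Fin N → ℚ, ∑ k, A k • f k = g j :=
    fun j => (Submodule.mem_span_range_iff_exists_fun ℚ).1 (hgF j)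
  choose A hA using hA
  have hmul : (Matrix.of fun i j => hasse (μ i) (g j)) =
      (Matrix.of fun i j => hasse (μ i) (f j)) * (Matrix.of fun k j => C (A j k)) := by
    ext1 i j
    rw [Matrix.mul_apply, Matrix.of_apply, ← hA j, hasse_sum]
    refine Finset.sum_congr rfl fun k _ => ?_
    ext e
    rw [Matrix.of_apply, Matrix.of_apply, mul_comm, coeff_C_mul, coeff_hasse, coeff_hasse,
      coeff_smul, smul_eq_mul]
    ring
  have h1 : (Matrix.of fun i j => hasse (μ i) (g j)).det = 0 := by
    rw [hmul, Matrix.det_mul, h0, zero_mul]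
  have h2 : (Matrix.of fun i j =>
      (monomial (μ i) (1 : ℚ)) * (Matrix.of fun i j => hasse (μ i) (g j)) i j).det = 0 := by
    rw [Matrix.det_mul_column, h1, mul_zero]
  have h3 := congrArg (coeff (∑ j, m.degree (g j))) h2
  rw [Matrix.det_apply, coeff_sum, coeff_zero] at h3
  have h4 : ∀ τ : Equiv.Perm (Fin N),
      coeff (∑ j, m.degree (g j)) (Equiv.Perm.sign τ • ∏ j, (Matrix.of fun i j =>
        (monomial (μ i) (1 : ℚ)) * (Matrix.of fun i j => hasse (μ i) (g j)) i j) (τ j) j) =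
      (Equiv.Perm.sign τ • ∏ j, (Matrix.of fun i j =>
        (multichoose (m.degree (g j)) (μ i) : ℚ)) (τ j) j) * ∏ j, m.leadingCoeff (g j) := by
    intro τ
    rw [Units.smul_def, coeff_smul, coeff_prod_of_degree_le m, Units.smul_def, smul_mul_assoc,
      ← Finset.prod_mul_distrib]
    · congr 1
      refine Finset.prod_congr rfl fun j _ => ?_
      simp only [Matrix.of_apply]
      rw [coeff_monomial_mul_hasse]
      rfl
    · intro j _
      simp only [Matrix.of_apply]
      rw [m.degree_le_iff]
      intro e he
      rw [mem_support_iff, coeff_monomial_mul_hasse] at he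
      exact m.le_degree (mem_support_iff.2 (right_ne_zero_of_mul he))
  simp_rw [h4] at h3
  rw [← Finset.sum_mul, ← Matrix.det_apply] at h3
  rcases mul_eq_zero.1 h3 with h | h
  · exact hdet h
  · obtain ⟨j, -, hj⟩ := Finset.prod_eq_zero_iff.1 h
    exact m.leadingCoeff_ne_zero_iff.2 (hg0 j) hj

end Wronskian

section Separation

variable {R : Type*} [CommRing R] {n : ℕ}

/-- A polynomial in one variable, seen as a polynomial in the first of `n + 1` variables. -/
noncomputable def headEmb : MvPolynomial (Fin 1) R →ₐ[R] MvPolynomial (Fin (n + 1)) R :=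
  rename fun _ => 0

/-- A polynomial in `n` variables, seen as a polynomial in the last of `n + 1` variables. -/
noncomputable def tailEmb : MvPolynomial (Fin n) R →ₐ[R] MvPolynomial (Fin (n + 1)) R :=
  rename Fin.succ

lemma headEmb_mul_tailEmb_monomial (s : Fin 1 →₀ ℕ) (t : Fin n →₀ ℕ) (a b : R) :
    headEmb (monomial s a) * tailEmb (monomial t b) =
      monomial (Finsupp.cons (s 0) t) (a * b) := by
  rw [headEmb, tailEmb, rename_monomial, rename_monomial, monomial_mul]
  congr 2
  ext i
  rw [Finsupp.add_apply]
  refine Fin.cases ?_ (fun i => ?_) i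
  · rw [Finsupp.mapDomain_of_notMem_range (f := Fin.succ) _ _ (by simp), Finsupp.cons_zero,
      add_zero]
    exact Finsupp.mapDomain_apply (fun _ _ _ => Subsingleton.elim _ _) s 0
  · rw [Finsupp.mapDomain_apply (Fin.succ_injective n), Finsupp.cons_succ,
      Finsupp.mapDomain_of_notMem_range (f := fun _ : Fin 1 => (0 : Fin (n + 1))) _ _
        (by simp), zero_add]

lemma coeff_headEmb_mul_tailEmb (a : MvPolynomial (Fin 1) R) (b : MvPolynomial (Fin n) R)
    (k : ℕ) (e : Fin n →₀ ℕ) :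
    coeff (Finsupp.cons k e) (headEmb a * tailEmb b) =
      coeff (Finsupp.single 0 k) a * coeff e b := by
  classical
  induction a using MvPolynomial.induction_on' with
  | add p q hp hq => rw [map_add, add_mul, coeff_add, hp, hq, coeff_add, add_mul]
  | monomial s c =>
    induction b using MvPolynomial.induction_on' with
    | add p q hp hq => rw [map_add, mul_add, coeff_add, hp, hq, coeff_add, mul_add]
    | monomial t c' =>
      rw [headEmb_mul_tailEmb_monomial, coeff_monomial, coeff_monomial, coeff_monomial,
        ite_mul, mul_ite, zero_mul, mul_zero, ← ite_and]
      congr 1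
      rw [eq_iff_iff]
      constructor
      · intro h
        have h0 := DFunLike.congr_fun h 0
        rw [Finsupp.cons_zero, Finsupp.cons_zero] at h0
        refine ⟨?_, ?_⟩
        · ext
          rw [Fin.default_eq_zero, h0, Finsupp.single_eq_same]
        · ext i
          simpa using DFunLike.congr_fun h i.succ
      · rintro ⟨rfl, rfl⟩
        simp

lemma hasse_headEmb_mul_tailEmb (a : MvPolynomial (Fin 1) R) (b : MvPolynomial (Fin n) R)
    (l : ℕ) (μ : Fin n →₀ ℕ) :
    hasse (Finsupp.cons l μ) (headEmb a * tailEmb b) =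
      headEmb (hasse (Finsupp.single 0 l) a) * tailEmb (hasse μ b) := by
  ext e
  rw [← Finsupp.cons_tail e, coeff_hasse, coeff_headEmb_mul_tailEmb]
  have h : Finsupp.cons (e 0) e.tail + Finsupp.cons l μ = Finsupp.cons (e 0 + l) (e.tail + μ) := by
    ext i
    refine Fin.cases ?_ (fun i => ?_) i <;> simp [Finsupp.tail_apply]
  rw [h, coeff_headEmb_mul_tailEmb, coeff_hasse, coeff_hasse, ← Finsupp.single_add]
  simp only [multichoose, Fin.prod_univ_succ, Finsupp.cons_zero, Finsupp.cons_succ,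
    Finset.univ_unique, Fin.default_eq_zero, Finset.prod_singleton, Finsupp.single_eq_same,
    Finsupp.add_apply]
  push_cast
  ring

lemma shift_headEmb (r : Fin (n + 1) → R) (a : MvPolynomial (Fin 1) R) :
    shift r (headEmb a) = headEmb (shift (fun _ => r 0) a) := by
  have : (shift r).comp (headEmb (R := R) (n := n)) = headEmb.comp (shift fun _ => r 0) := by
    ext i
    simp [shift, headEmb]
  exact AlgHom.congr_fun this a

lemma shift_tailEmb (r : Fin (n + 1) → R) (b : MvPolynomial (Fin n) R) :
    shift r (tailEmb b) = tailEmb (shift (fun i => r i.succ) b) := by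
  have : (shift r).comp (tailEmb (R := R)) = tailEmb.comp (shift fun i => r i.succ) := by
    ext i
    simp [shift, tailEmb]
  exact AlgHom.congr_fun this b

end Separation

section Decomposition

variable {n : ℕ}

lemma exists_linearIndependent_decomposition (P : MvPolynomial (Fin (n + 1)) ℚ) (d : ℕ)
    (hd : degreeOf 0 P ≤ d) :
    ∃ N ≤ d + 1, ∃ (g : Fin N → MvPolynomial (Fin 1) ℚ) (f : Fin N → MvPolynomial (Fin n) ℚ),
      LinearIndependent ℚ g ∧ LinearIndependent ℚ f ∧
        P = ∑ j, headEmb (g j) * tailEmb (f j) := by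
  classical
  let c : Fin (d + 1) → MvPolynomial (Fin n) ℚ := fun k => (finSuccEquiv ℚ n P).coeff k
  let F := Submodule.span ℚ (Set.range c)
  have : FiniteDimensional ℚ F := FiniteDimensional.span_of_finite ℚ (Set.finite_range c)
  let b := Module.finBasis ℚ F
  let c' : Fin (d + 1) → F := fun k => ⟨c k, Submodule.subset_span ⟨k, rfl⟩⟩
  have hc' : Submodule.span ℚ (Set.range c') = ⊤ := by
    have := Submodule.span_span_coe_preimage (R := ℚ) (s := Set.range c)
    convert this using 2
    ext x
    constructor
    · rintro ⟨k, rfl⟩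
      exact ⟨k, rfl⟩
    · rintro ⟨k, hk⟩
      exact ⟨k, Subtype.ext hk⟩
  refine ⟨Module.finrank ℚ F, ?_, fun j => ∑ k, monomial (Finsupp.single 0 k.1) (b.repr (c' k) j),
    fun j => (b j : MvPolynomial (Fin n) ℚ), ?_, ?_, ?_⟩
  · exact (finrank_range_le_card (R := ℚ) c).trans (Fintype.card_fin _).le
  · rw [Fintype.linearIndependent_iff]
    intro a ha
    have hk : ∀ k, ∑ j, a j * b.repr (c' k) j = 0 := by
      intro k
      have := congrArg (coeff (Finsupp.single 0 k.1)) ha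
      simp only [coeff_sum, coeff_smul, coeff_monomial, coeff_zero] at this
      rw [← this]
      refine Finset.sum_congr rfl fun j _ => ?_
      rw [smul_eq_mul]
      congr 1
      rw [Finset.sum_eq_single k]
      · simp
      · intro l _ hl
        rw [if_neg]
        intro h
        exact hl (Fin.ext (by simpa using DFunLike.congr_fun h 0))
      · simp
    let T : F →ₗ[ℚ] ℚ := ∑ j, a j • b.coord j
    have hT : T = 0 := by
      refine LinearMap.ext_on_range hc' fun k => ?_
      simpa [T] using hk k
    intro j
    simpa [T, Finsupp.single_apply] using LinearMap.congr_fun hT (b j)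
  · exact b.linearIndependent.map' F.subtype (Submodule.ker_subtype F)
  · ext e
    rw [← Finsupp.cons_tail e, coeff_sum]
    simp only [coeff_headEmb_mul_tailEmb, coeff_sum, coeff_monomial]
    by_cases he : e 0 ≤ d
    · have h1 : ∀ j, (∑ k : Fin (d + 1), if Finsupp.single (0 : Fin 1) k.1 =
          Finsupp.single 0 (e 0) then b.repr (c' k) j else 0) =
            b.repr (c' ⟨e 0, Nat.lt_succ_of_le he⟩) j := by
        intro j
        rw [Finset.sum_eq_single ⟨e 0, Nat.lt_succ_of_le he⟩]
        · simp
        · intro l _ hl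
          rw [if_neg]
          intro h
          exact hl (Fin.ext (by simpa using DFunLike.congr_fun h 0))
        · simp
      simp only [h1]
      have h2 := congrArg (fun x : F => coeff e.tail (x : MvPolynomial (Fin n) ℚ))
        (b.sum_repr (c' ⟨e 0, Nat.lt_succ_of_le he⟩))
      simp only [Submodule.coe_sum, Submodule.coe_smul, coeff_sum, coeff_smul, smul_eq_mul] at h2
      rw [h2]
      exact (finSuccEquiv_coeff_coeff _ _ _).symm
    · have h1 : coeff (Finsupp.cons (e 0) e.tail) P = 0 := by
        by_contra h
        refine he ((degreeOf_le_iff.1 hd) _ (mem_support_iff.2 h) |>.trans' ?_)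
        simp
      rw [h1, Finset.sum_eq_zero]
      intro j _
      rw [Finset.sum_eq_zero, zero_mul]
      intro k _
      rw [if_neg]
      intro h
      have := DFunLike.congr_fun h 0
      simp only [Finsupp.single_eq_same] at this
      have := k.2
      omega

end Decomposition

section SeparatedDeterminant

variable {n : ℕ}

lemma exists_hasse_det_ne_zero_one_variable {N : ℕ} (g : Fin N → MvPolynomial (Fin 1) ℚ)
    (hg : LinearIndependent ℚ g) :
    (Matrix.of fun i j : Fin N => hasse (Finsupp.single 0 (i : ℕ)) (g j)).det ≠ 0 := by
  obtain ⟨ν, hν, hdet⟩ := exists_hasse_det_ne_zero g hg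
  have hν' : ∀ i, ν i = Finsupp.single 0 (ν i 0) := fun i => by
    ext
    simp
  have hlt : ∀ i, ν i 0 < N := fun i => by
    have := hν i
    rw [hν' i] at this
    simpa using this
  let τ : Fin N → Fin N := fun i => ⟨ν i 0, hlt i⟩
  have hτ : Function.Injective τ := by
    intro i i' h
    by_contra hne
    refine hdet (Matrix.det_zero_of_row_eq hne ?_)
    have : ν i = ν i' := by
      rw [hν' i, hν' i', show ν i 0 = ν i' 0 from congrArg Fin.val h]
    ext1 j
    simp [this]
  let σ : Equiv.Perm (Fin N) := Equiv.ofBijective τ (Finite.injective_iff_bijective.1 hτ)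
  intro h0
  refine hdet ?_
  have : (Matrix.of fun i j => hasse (ν i) (g j)) =
      (Matrix.of fun i j : Fin N => hasse (Finsupp.single 0 (i : ℕ)) (g j)).submatrix σ id := by
    ext1 i j
    simp only [Matrix.of_apply, Matrix.submatrix_apply, id]
    rw [hν' i]
    rfl
  rw [this, Matrix.det_permute, h0, mul_zero]

theorem exists_separated_det (P : MvPolynomial (Fin (n + 1)) ℤ) (hP : P ≠ 0) (d : ℕ)
    (hd : degreeOf 0 P ≤ d) :
    ∃ N, 1 ≤ N ∧ N ≤ d + 1 ∧ ∃ μ : Fin N → (Fin n →₀ ℕ), (∀ i, (μ i).degree < N) ∧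
      ∃ (V : MvPolynomial (Fin 1) ℚ) (U : MvPolynomial (Fin n) ℚ), V ≠ 0 ∧ U ≠ 0 ∧
        map (Int.castRingHom ℚ)
          (Matrix.of fun i j : Fin N => hasse (Finsupp.cons (j : ℕ) (μ i)) P).det =
            headEmb V * tailEmb U := by
  have hinj := map_injective (σ := Fin (n + 1)) (Int.castRingHom ℚ) (RingHom.injective_int _)
  have hd' : degreeOf 0 (map (Int.castRingHom ℚ) P) ≤ d := by
    rw [degreeOf_le_iff] at hd ⊢
    exact fun e he => hd e (support_map_subset _ _ he)
  obtain ⟨N, hN, g, f, hg, hf, hPsum⟩ := exists_linearIndependent_decomposition _ d hd'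
  obtain ⟨μ, hμ, hU⟩ := exists_hasse_det_ne_zero f hf
  refine ⟨N, ?_, hN, μ, hμ, _, _, exists_hasse_det_ne_zero_one_variable g hg, hU, ?_⟩
  · by_contra h0
    obtain rfl : N = 0 := by omega
    rw [Finset.univ_eq_empty, Finset.sum_empty, ← map_zero (map (Int.castRingHom ℚ))] at hPsum
    exact hP (hinj hPsum)
  · rw [RingHom.map_det, AlgHom.map_det, AlgHom.map_det, mul_comm,
      ← Matrix.det_transpose (headEmb.mapMatrix _), ← Matrix.det_mul]
    congr 1
    ext1 i j
    simp only [RingHom.mapMatrix_apply, AlgHom.mapMatrix_apply, Matrix.map_apply,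
      Matrix.mul_apply, Matrix.transpose_apply, Matrix.of_apply]
    rw [map_hasse, hPsum, hasse_sum]
    exact Finset.sum_congr rfl fun k _ => by rw [hasse_headEmb_mul_tailEmb, mul_comm]

end SeparatedDeterminant

section OneVariable

open Polynomial in
lemma den_pow_le_leadingCoeff (V : ℤ[X]) (hV : V ≠ 0) (r : ℚ) :
    ∃ k, ((V.map (Int.castRingHom ℚ)).comp (Polynomial.X + Polynomial.C r)).coeff k ≠ 0 ∧
      (r.den : ℤ) ^ k ≤ |V.leadingCoeff| := by
  set W := V.map (Int.castRingHom ℚ)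
  have hW : W ≠ 0 := (Polynomial.map_ne_zero_iff (RingHom.injective_int _)).2 hV
  refine ⟨W.rootMultiplicity r, ?_, ?_⟩
  · rw [Polynomial.rootMultiplicity_eq_natTrailingDegree]
    have : W.comp (Polynomial.X + Polynomial.C r) ≠ 0 := by
      rw [Ne, Polynomial.comp_X_add_C_eq_zero_iff]
      exact hW
    exact Polynomial.trailingCoeff_nonzero_iff_nonzero.2 this
  · set k := W.rootMultiplicity r
    let L : ℤ[X] := Polynomial.C (r.den : ℤ) * Polynomial.X - Polynomial.C r.num
    have hLprim : L.IsPrimitive := by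
      intro c hc
      rw [Polynomial.C_dvd_iff_dvd_coeff] at hc
      have h0 := hc 0
      have h1 := hc 1
      simp only [L, Polynomial.coeff_sub, Polynomial.coeff_C_mul, Polynomial.coeff_X_zero,
        Polynomial.coeff_X_one, Polynomial.coeff_C_zero, Polynomial.coeff_C_succ, mul_zero,
        mul_one, zero_sub, sub_zero, dvd_neg] at h0 h1
      refine isUnit_of_dvd_one ?_
      have h := Int.dvd_coe_gcd h0 h1
      rwa [show Int.gcd r.num r.den = 1 from r.reduced, Nat.cast_one] at h
    have hLpow : (L ^ k).IsPrimitive := by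
      induction k with
      | zero => rw [pow_zero]; exact Polynomial.isPrimitive_one
      | succ k ih => rw [pow_succ]; exact ih.mul hLprim
    have hden : (r.den : ℚ) ≠ 0 := by exact_mod_cast r.den_ne_zero
    have hLmap : L.map (Int.castRingHom ℚ) =
        Polynomial.C (r.den : ℚ) * (Polynomial.X - Polynomial.C r) := by
      simp only [L, Polynomial.map_sub, Polynomial.map_mul, Polynomial.map_C, Polynomial.map_X,
        mul_sub, ← Polynomial.C_mul]
      congr 2
      simp
    have hdvd : L ^ k ∣ V := by
      rw [Polynomial.IsPrimitive.Int.dvd_iff_map_cast_dvd_map_cast _ _ hLpow,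
        Polynomial.map_pow, hLmap, mul_pow, ← Polynomial.C_pow]
      exact (Polynomial.C_mul_dvd (pow_ne_zero k hden)).2 (Polynomial.pow_rootMultiplicity_dvd W r)
    have hlc : (r.den : ℤ) ^ k ∣ V.leadingCoeff := by
      have h := Polynomial.leadingCoeff_dvd_leadingCoeff hdvd
      have hL : L.leadingCoeff = r.den := by
        simpa [L, sub_eq_add_neg] using
          Polynomial.leadingCoeff_linear (a := (r.den : ℤ)) (b := -r.num)
            (by exact_mod_cast r.den_ne_zero)
      rwa [Polynomial.leadingCoeff_pow, hL] at h
    exact Int.le_of_dvd (abs_pos.2 (Polynomial.leadingCoeff_ne_zero.2 hV))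
      ((dvd_abs _ _).2 hlc)

end OneVariable

section Separated

variable {n : ℕ}

lemma coeff_aeval_X (V : MvPolynomial (Fin 1) ℚ) (k : ℕ) :
    (aeval (fun _ => (Polynomial.X : Polynomial ℚ)) V).coeff k = coeff (Finsupp.single 0 k) V := by
  classical
  induction V using MvPolynomial.induction_on' with
  | add p q hp hq => rw [map_add, Polynomial.coeff_add, hp, hq, coeff_add]
  | monomial s c =>
    rw [aeval_monomial, coeff_monomial, Finsupp.prod_pow, Finset.univ_unique,
      Finset.prod_singleton, Polynomial.algebraMap_eq, Polynomial.coeff_C_mul_X_pow]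
    congr 1
    rw [eq_iff_iff]
    constructor
    · rintro rfl
      ext
      simp
    · rintro rfl
      simp

lemma aeval_X_shift (V : MvPolynomial (Fin 1) ℚ) (r : ℚ) :
    aeval (fun _ => (Polynomial.X : Polynomial ℚ)) (shift (fun _ => r) V) =
      (aeval (fun _ => (Polynomial.X : Polynomial ℚ)) V).comp
        (Polynomial.X + Polynomial.C r) := by
  have : (aeval (fun _ => (Polynomial.X : Polynomial ℚ))).comp (shift (fun _ : Fin 1 => r)) =
      (Polynomial.aeval (R := ℚ) (Polynomial.X + Polynomial.C r)).comp
        (aeval (fun _ => (Polynomial.X : Polynomial ℚ))) := by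
    ext1 i
    simp [shift]
  exact AlgHom.congr_fun this V

lemma exists_coeff_ne_zero_of_separated (W : MvPolynomial (Fin (n + 1)) ℤ)
    (V : MvPolynomial (Fin 1) ℚ) (U : MvPolynomial (Fin n) ℚ) (hV : V ≠ 0) (hU : U ≠ 0)
    (hW : map (Int.castRingHom ℚ) W = headEmb V * tailEmb U) (r : Fin (n + 1) → ℚ) :
    ∃ U' : MvPolynomial (Fin n) ℤ, U' ≠ 0 ∧ l1 U' ≤ l1 W ∧
      (∀ i, degreeOf i U' ≤ degreeOf i.succ W) ∧
      ∃ k : ℕ, ((r 0).den : ℝ) ^ k ≤ l1 W ∧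
        ∀ e, coeff e (shift (fun i => r i.succ) (map (Int.castRingHom ℚ) U')) ≠ 0 →
          coeff (Finsupp.cons k e) (shift r (map (Int.castRingHom ℚ) W)) ≠ 0 := by
  classical
  have hcoeff : ∀ k e, ((coeff (Finsupp.cons k e) W : ℤ) : ℚ) =
      coeff (Finsupp.single 0 k) V * coeff e U := fun k e => by
    rw [← coeff_headEmb_mul_tailEmb, ← hW, coeff_map]
    rfl
  obtain ⟨s, hs⟩ := ne_zero_iff.1 hV
  obtain ⟨e₀, he₀⟩ := ne_zero_iff.1 hU
  have hs' : s = Finsupp.single 0 (s 0) := by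
    ext
    simp
  rw [hs'] at hs
  set k₀ := s 0
  refine ⟨(finSuccEquiv ℤ n W).coeff k₀, ?_, ?_, fun i => degreeOf_coeff_finSuccEquiv _ _ _, ?_⟩
  · rw [ne_zero_iff]
    refine ⟨e₀, ?_⟩
    rw [finSuccEquiv_coeff_coeff]
    have := hcoeff k₀ e₀
    intro h0
    rw [h0, Int.cast_zero] at this
    exact mul_ne_zero hs he₀ this.symm
  · have h := l1_eq_sum (P := W) (T := W.support ∪
      ((finSuccEquiv ℤ n W).coeff k₀).support.image (Finsupp.cons k₀)) Finset.subset_union_left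
    rw [h, l1]
    simp only [finSuccEquiv_coeff_coeff]
    rw [← Finset.sum_image (f := fun e => ‖coeff e W‖) (g := Finsupp.cons k₀)]
    · exact Finset.sum_le_sum_of_subset_of_nonneg Finset.subset_union_right
        fun _ _ _ => norm_nonneg _
    · exact fun _ _ _ _ h => Finsupp.cons_right_injective _ h
  · set T : Polynomial ℚ := aeval (fun _ => (Polynomial.X : Polynomial ℚ)) V with hT
    let V' : Polynomial ℤ := ∑ k ∈ Finset.range (T.natDegree + 1),
      Polynomial.monomial k (coeff (Finsupp.cons k e₀) W)
    have hV'c : ∀ k, V'.coeff k = coeff (Finsupp.cons k e₀) W := by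
      intro k
      simp only [V', Polynomial.finsetSum_coeff, Polynomial.coeff_monomial,
        Finset.sum_ite_eq', Finset.mem_range]
      split_ifs with hk
      · rfl
      · have h1 := hcoeff k e₀
        rw [← coeff_aeval_X, ← hT, Polynomial.coeff_eq_zero_of_natDegree_lt (by omega), zero_mul] at h1
        exact_mod_cast h1.symm
    have hV' : V'.map (Int.castRingHom ℚ) = Polynomial.C (coeff e₀ U) * T := by
      ext k
      rw [Polynomial.coeff_map, hV'c, Polynomial.coeff_C_mul, hT, coeff_aeval_X, mul_comm]
      exact hcoeff k e₀
    have hV'0 : V' ≠ 0 := by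
      intro h0
      have h1 := hV'c k₀
      rw [h0, Polynomial.coeff_zero] at h1
      have h2 := hcoeff k₀ e₀
      rw [← h1, Int.cast_zero] at h2
      exact mul_ne_zero hs he₀ h2.symm
    obtain ⟨k, hk, hk'⟩ := den_pow_le_leadingCoeff V' hV'0 (r 0)
    refine ⟨k, ?_, fun e he => ?_⟩
    · have h1 : ((r 0).den : ℝ) ^ k ≤ ((|V'.leadingCoeff| : ℤ) : ℝ) := by exact_mod_cast hk'
      refine h1.trans ?_
      rw [Polynomial.leadingCoeff, hV'c]
      exact (by rw [Int.cast_abs]; rfl : _ = _).trans_le (norm_coeff_le_l1 W (Finsupp.cons V'.natDegree e₀))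
    · rw [hW, map_mul, shift_headEmb, shift_tailEmb, coeff_headEmb_mul_tailEmb]
      refine mul_ne_zero ?_ ?_
      · rw [hV', Polynomial.mul_comp, Polynomial.C_comp, Polynomial.coeff_C_mul, hT,
          ← aeval_X_shift, coeff_aeval_X] at hk
        exact right_ne_zero_of_mul hk
      · have : map (Int.castRingHom ℚ) ((finSuccEquiv ℤ n W).coeff k₀) =
            C (coeff (Finsupp.single 0 k₀) V) * U := by
          ext e
          rw [coeff_map, finSuccEquiv_coeff_coeff, coeff_C_mul]
          exact hcoeff k₀ e
        rw [this, map_mul] at he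
        have hC : shift (fun i : Fin n => r i.succ) (C (coeff (Finsupp.single 0 k₀) V)) =
            C (coeff (Finsupp.single 0 k₀) V) := by simp [shift]
        rw [hC, coeff_C_mul] at he
        exact right_ne_zero_of_mul he

end Separated

section RothLemma

lemma le_sum_max_of_pos (N D : ℕ) (δ : ℝ) (hD : 1 ≤ D) (hN : (N : ℝ) ≤ δ * D + 1) :
    N * δ / 2 ≤ ∑ l ∈ Finset.range N, max 0 (δ - l / D) := by
  have hD' : (0 : ℝ) < D := by exact_mod_cast hD
  have h1 : ∀ N : ℕ, ∑ l ∈ Finset.range N, (δ - (l : ℝ) / D) = N * δ - N * (N - 1) / (2 * D) := by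
    intro N
    induction N with
    | zero => simp
    | succ N ih =>
      rw [Finset.sum_range_succ, ih]
      push_cast
      field_simp
      ring
  refine le_trans ?_ (Finset.sum_le_sum fun l _ => le_max_right 0 (δ - (l : ℝ) / D))
  rw [h1]
  have h2 : (N : ℝ) * (N - 1) / (2 * D) ≤ N * δ / 2 := by
    rw [div_le_div_iff₀ (by positivity) (by norm_num)]
    have : (0 : ℝ) ≤ N := Nat.cast_nonneg _
    nlinarith
  linarith

lemma le_sum_max (N D : ℕ) (δ : ℝ) (hD : 1 ≤ D) (hN : N ≤ D + 1) (h0 : 0 ≤ δ) (h1 : δ ≤ 1) :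
    N * δ ^ 2 / 4 ≤ ∑ l : Fin N, max 0 (δ - (l : ℕ) / D) := by
  rw [Fin.sum_univ_eq_sum_range (fun l => max 0 (δ - (l : ℝ) / D))]
  have hN0 : (0 : ℝ) ≤ N := Nat.cast_nonneg _
  rcases le_or_gt (N : ℝ) (δ * D + 1) with h | h
  · refine le_trans ?_ (le_sum_max_of_pos N D δ hD h)
    have h2 : (N : ℝ) * δ ^ 2 ≤ N * (2 * δ) := by
      gcongr
      nlinarith
    linarith
  · have hD' : (1 : ℝ) ≤ D := by exact_mod_cast hD
    have hpos : 0 ≤ δ * D := by positivity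
    have hN' : (N : ℝ) ≤ D + 1 := by exact_mod_cast hN
    have hlt : ⌊δ * D⌋₊ + 1 ≤ N := by
      have h2 : (⌊δ * D⌋₊ : ℝ) + 1 < N := by linarith [Nat.floor_le hpos]
      exact_mod_cast h2.le
    have h3 := le_sum_max_of_pos (⌊δ * D⌋₊ + 1) D δ hD (by
      push_cast
      linarith [Nat.floor_le hpos])
    refine le_trans ?_ (h3.trans (Finset.sum_le_sum_of_subset_of_nonneg
      (Finset.range_mono hlt) fun _ _ _ => le_max_left _ _))
    have h4 := (Nat.lt_floor_add_one (δ * D)).le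
    push_cast
    have h5 : δ * D * δ / 2 ≤ (⌊δ * D⌋₊ + 1) * δ / 2 := by gcongr
    refine le_trans ?_ h5
    nlinarith [sq_nonneg δ]

lemma indexGE_neg_single_iff {n : ℕ} {R : Type*} [CommRing R] (P : MvPolynomial (Fin n) R)
    (i : Fin n) (d : ℕ) : IndexGE (Pi.single i (-1)) (-(d : ℝ)) P ↔ degreeOf i P ≤ d := by
  have hwt : ∀ e : Fin n →₀ ℕ, wt (Pi.single i (-1)) e = -(e i : ℝ) := by
    intro e
    rw [wt, Finset.sum_eq_single i]
    · simp
    · intro j _ hj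
      simp [hj]
    · simp
  rw [degreeOf_le_iff]
  simp only [IndexGE, hwt, neg_le_neg_iff, Nat.cast_le, mem_support_iff, ne_eq]

lemma degreeOf_det_hasse_le {n N : ℕ} (P : MvPolynomial (Fin n) ℤ) (i : Fin n) (d : ℕ)
    (hd : degreeOf i P ≤ d) (μ : Fin N → Fin N → (Fin n →₀ ℕ)) :
    degreeOf i (Matrix.of fun k l => hasse (μ k l) P).det ≤ N * d := by
  have h := IndexGE.det (w := Pi.single i (-1)) (fun _ => -(d : ℝ))
    (Matrix.of fun k l => hasse (μ k l) P) fun k l => ?_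
  · rw [← indexGE_neg_single_iff]
    simpa using h
  · rw [indexGE_neg_single_iff, degreeOf_le_iff]
    intro e he
    rw [Matrix.of_apply, mem_support_iff, coeff_hasse] at he
    have h2 := degreeOf_le_iff.1 hd _ (mem_support_iff.2 (right_ne_zero_of_mul he))
    rw [Finsupp.add_apply] at h2
    omega

lemma l1_det_hasse_le {n N : ℕ} (P : MvPolynomial (Fin n) ℤ) (d : Fin n → ℕ) (h : ℝ)
    (hd : ∀ i, degreeOf i P ≤ d i) (hP : l1 P ≤ Real.exp h) (hh : (∑ i, d i : ℝ) ≤ h)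
    (hN : (N : ℝ) ≤ h + 1) (μ : Fin N → Fin N → (Fin n →₀ ℕ)) :
    l1 (Matrix.of fun k l => hasse (μ k l) P).det ≤ Real.exp (3 * N * h) := by
  have h2 : (2 : ℝ) ^ ∑ i, d i ≤ Real.exp h := by
    have he : (2 : ℝ) ≤ Real.exp 1 := by linarith [Real.add_one_le_exp (1 : ℝ)]
    calc (2 : ℝ) ^ ∑ i, d i ≤ Real.exp 1 ^ ∑ i, d i := by gcongr
      _ = Real.exp (∑ i, d i : ℝ) := by rw [← Real.exp_nat_mul, mul_one]; push_cast; rfl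
      _ ≤ Real.exp h := Real.exp_le_exp.2 hh
  have hent : ∀ k l, l1 ((Matrix.of fun k l => hasse (μ k l) P) k l) ≤ Real.exp (2 * h) := by
    intro k l
    rw [Matrix.of_apply, two_mul, Real.exp_add]
    exact (l1_hasse_le _ P d hd).trans
      (mul_le_mul h2 hP (l1_nonneg _) (Real.exp_nonneg _))
  refine (l1_det_le _ _ hent).trans ?_
  have hfac : (N.factorial : ℝ) ≤ Real.exp h ^ N := by
    calc (N.factorial : ℝ) ≤ (N : ℝ) ^ N := by exact_mod_cast Nat.factorial_le_pow N
      _ ≤ Real.exp h ^ N := by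
        gcongr
        exact hN.trans (Real.add_one_le_exp h)
  calc (N.factorial : ℝ) * Real.exp (2 * h) ^ N ≤ Real.exp h ^ N * Real.exp (2 * h) ^ N := by
        gcongr
    _ = Real.exp (3 * N * h) := by
        rw [← Real.exp_nat_mul, ← Real.exp_nat_mul, ← Real.exp_add]
        congr 1
        ring

lemma IndexGE.mono {σ R : Type*} [Fintype σ] [CommRing R] {w : σ → ℝ} {θ θ' : ℝ}
    {P : MvPolynomial σ R} (hP : IndexGE w θ P) (h : θ' ≤ θ) : IndexGE w θ' P :=
  fun e he => h.trans (hP e he)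

lemma wt_cons {n : ℕ} (w : Fin (n + 1) → ℝ) (k : ℕ) (e : Fin n →₀ ℕ) :
    wt w (Finsupp.cons k e) = w 0 * k + wt (fun i => w i.succ) e := by
  simp [wt, Fin.sum_univ_succ]

lemma index_det_hasse {n N D : ℕ} (w : Fin (n + 1) → ℝ) (hw : ∀ i, 0 ≤ w i) (hD : 1 ≤ D)
    (hw0 : w 0 = 1 / D) (hN : N ≤ D + 1) (ε : ℝ) (hε0 : 0 < ε) (hε1 : ε ≤ 1)
    (hws : ∀ i : Fin n, w i.succ * D ≤ ε / 2)
    (P : MvPolynomial (Fin (n + 1)) ℚ) (hP : IndexGE w ε P) (μ : Fin N → (Fin n →₀ ℕ))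
    (hμ : ∀ i, (μ i).degree < N) :
    IndexGE w (N * ε ^ 2 / 16)
      (Matrix.of fun i j : Fin N => hasse (Finsupp.cons (j : ℕ) (μ i)) P).det := by
  have hDpos : (0 : ℝ) < D := by exact_mod_cast hD
  have h := IndexGE.det (w := w) (fun j : Fin N => max 0 (ε / 2 - (j : ℕ) / D))
    (Matrix.of fun i j : Fin N => hasse (Finsupp.cons (j : ℕ) (μ i)) P) fun i j => ?_
  · refine h.mono ?_
    have := le_sum_max N D (ε / 2) hD hN (by linarith) (by linarith)
    refine le_trans (le_of_eq ?_) this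
    ring
  · rw [Matrix.of_apply]
    rcases le_total (ε / 2 - (j : ℕ) / D : ℝ) 0 with h0 | h0
    · rw [max_eq_left h0]
      exact fun e _ => wt_nonneg hw e
    · rw [max_eq_right h0]
      refine (hP.hasse _).mono ?_
      rw [wt_cons, hw0]
      have h1 : wt (fun i => w i.succ) (μ i) ≤ ε / 2 := by
        have hdeg : (∑ k, (μ i k : ℝ)) ≤ D := by
          have h2 := hμ i
          rw [Finsupp.degree_eq_sum] at h2
          exact_mod_cast (by omega : ∑ k, μ i k ≤ D)
        calc wt (fun i => w i.succ) (μ i) ≤ ∑ k, ε / 2 / D * (μ i k : ℝ) := by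
              refine Finset.sum_le_sum fun k _ => ?_
              gcongr
              rw [le_div_iff₀ hDpos]
              exact hws k
          _ = ε / 2 / D * ∑ k, (μ i k : ℝ) := by rw [Finset.mul_sum]
          _ ≤ ε / 2 / D * D := by gcongr
          _ = ε / 2 := by field_simp
      have h3 : (1 : ℝ) / D * (j : ℕ) = (j : ℕ) / D := by ring
      linarith

end RothLemma

/-- **Roth's lemma**: a nonzero integer polynomial has small index at a rational point whose
coordinates have large, rapidly increasing denominators. -/
theorem roth_lemma (n : ℕ) : ∀ ε : ℝ, 0 < ε → ε ≤ 1 → ∃ σ : ℝ, 0 < σ ∧ σ < 1 ∧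
    ∀ (d : Fin n → ℕ) (r : Fin n → ℚ) (h : ℝ) (P : MvPolynomial (Fin n) ℤ), P ≠ 0 →
      (∀ i, 1 ≤ d i) → (∀ i j, i < j → (d i : ℝ) ≤ σ * d j) → (∀ i, degreeOf i P ≤ d i) →
      l1 P ≤ Real.exp h → (∑ i, d i : ℝ) ≤ h → (∀ i, h ≤ σ * d i * Real.log (r i).den) →
      ∃ e, coeff e (shift r (map (Int.castRingHom ℚ) P)) ≠ 0 ∧
        wt (fun i => 1 / (d i : ℝ)) e < ε := by
  induction n with
  | zero =>
    intro ε hε _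
    refine ⟨1 / 2, by norm_num, by norm_num, fun d r h P hP _ _ _ _ _ _ => ?_⟩
    have h0 : shift r (map (Int.castRingHom ℚ) P) ≠ 0 := by
      intro h0
      rw [← map_zero (shift r)] at h0
      have h1 := shift_injective r h0
      rw [← map_zero (map (Int.castRingHom ℚ))] at h1
      exact hP (map_injective _ (RingHom.injective_int _) h1)
    obtain ⟨e, he⟩ := ne_zero_iff.1 h0
    exact ⟨e, he, by simpa [wt] using hε⟩
  | succ n ih =>
    intro ε hε hε1
    obtain ⟨σ₁, hσ₁, hσ₁', H⟩ := ih (ε ^ 2 / 64) (by positivity) (by nlinarith)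
    obtain ⟨σ, hσ, hσa, hσb, hσc⟩ : ∃ σ : ℝ, 0 < σ ∧ 3 * σ ≤ ε ^ 2 / 64 ∧ σ ≤ ε / 2 ∧
        3 * σ ≤ σ₁ := by
      refine ⟨min (ε ^ 2 / 192) (min (ε / 2) (σ₁ / 3)), ?_, ?_, ?_, ?_⟩
      · positivity
      · linarith [min_le_left (ε ^ 2 / 192) (min (ε / 2) (σ₁ / 3))]
      · exact (min_le_right _ _).trans (min_le_left _ _)
      · linarith [(min_le_right (ε ^ 2 / 192) (min (ε / 2) (σ₁ / 3))).trans (min_le_right _ _)]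
    refine ⟨σ, hσ, by linarith, fun d r h P hP hd1 hdσ hdeg hl1 hsum hlog => ?_⟩
    have hd1' : ∀ i, (1 : ℝ) ≤ d i := fun i => by exact_mod_cast hd1 i
    have hd0 : ∀ i, (0 : ℝ) < d i := fun i => zero_lt_one.trans_le (hd1' i)
    by_contra! hcon
    have hidx : IndexGE (fun i => 1 / (d i : ℝ)) ε (shift r (map (Int.castRingHom ℚ) P)) := hcon
    have hd0h : (d 0 : ℝ) ≤ h :=
      (Finset.single_le_sum (f := fun i => (d i : ℝ)) (fun i _ => (hd0 i).le)
        (Finset.mem_univ 0)).trans hsum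
    have hhpos : 0 < h := (hd0 0).trans_le hd0h
    obtain ⟨N, hN1, hN, μ, hμ, V, U, hV, hU, hW⟩ := exists_separated_det P hP (d 0) (hdeg 0)
    set W := (Matrix.of fun i j : Fin N => hasse (Finsupp.cons (j : ℕ) (μ i)) P).det with hWdef
    have hN0 : (1 : ℝ) ≤ N := by exact_mod_cast hN1
    have hNd : (N : ℝ) ≤ d 0 + 1 := by exact_mod_cast hN
    have hWl1 : l1 W ≤ Real.exp (3 * N * h) :=
      l1_det_hasse_le P d h hdeg hl1 hsum (by linarith) _
    have hWdeg : ∀ i, degreeOf i W ≤ N * d i := fun i => degreeOf_det_hasse_le P i _ (hdeg i) _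
    obtain ⟨U', hU', hU'l1, hU'deg, k, hk, hcoeff⟩ :=
      exists_coeff_ne_zero_of_separated W V U hV hU hW r
    obtain ⟨e, he, hwt⟩ := H (fun i => N * d i.succ) (fun i => r i.succ) (3 * N * h) U' hU'
      (fun i => Nat.mul_pos hN1 (hd1 _))
      (fun i j hij => by
        have h1 := hdσ i.succ j.succ (Fin.succ_lt_succ_iff.2 hij)
        have h2 : σ * d j.succ ≤ σ₁ * d j.succ :=
          mul_le_mul_of_nonneg_right (by linarith) (hd0 _).le
        push_cast
        nlinarith)
      (fun i => (hU'deg i).trans (hWdeg _)) (hU'l1.trans hWl1)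
      (by
        push_cast
        rw [← Finset.mul_sum]
        rw [Fin.sum_univ_succ] at hsum
        have : (∑ i : Fin n, (d i.succ : ℝ)) ≤ h := by linarith [hd0 0]
        nlinarith)
      (fun i => by
        have h1 := hlog i.succ
        have h2 : 0 ≤ (d i.succ : ℝ) * Real.log (r i.succ).den :=
          mul_nonneg (hd0 _).le (Real.log_natCast_nonneg _)
        have h3 : 3 * h ≤ σ₁ * (d i.succ * Real.log (r i.succ).den) := by nlinarith
        push_cast
        nlinarith)
    have hidxW : IndexGE (fun i => 1 / (d i : ℝ)) (N * ε ^ 2 / 16)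
        (shift r (map (Int.castRingHom ℚ) W)) := by
      have h1 : shift r (map (Int.castRingHom ℚ) W) =
          (Matrix.of fun i j : Fin N => hasse (Finsupp.cons (j : ℕ) (μ i))
            (shift r (map (Int.castRingHom ℚ) P))).det := by
        rw [hWdef, RingHom.map_det, AlgHom.map_det]
        congr 1
        ext1 i j
        simp [map_hasse, shift_hasse]
      rw [h1]
      refine index_det_hasse (D := d 0) _ (fun i => by positivity) (hd1 0) rfl hN ε hε hε1
        (fun i => ?_) _ hidx μ hμ
      rw [one_div, inv_mul_le_iff₀ (hd0 _)]
      nlinarith [hdσ 0 i.succ (Fin.succ_pos i), hd0 i.succ]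
    have hlow := hidxW _ (hcoeff e he)
    rw [wt_cons] at hlow
    have hlogpos : 0 < Real.log (r 0).den := by
      by_contra! hle
      have h1 := hlog 0
      have h2 : σ * d 0 * Real.log (r 0).den ≤ 0 :=
        mul_nonpos_of_nonneg_of_nonpos (mul_pos hσ (hd0 0)).le hle
      linarith
    have hkbound : 1 / (d 0 : ℝ) * k ≤ N * (3 * σ) := by
      have h1 : k * Real.log (r 0).den ≤ 3 * N * h := by
        rw [← Real.log_pow, Real.log_le_iff_le_exp (by have := (r 0).den_pos; positivity)]
        exact hk.trans hWl1
      have h2 : k * Real.log (r 0).den ≤ (N * (3 * σ) * d 0) * Real.log (r 0).den := by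
        have := mul_le_mul_of_nonneg_left (hlog 0) (by positivity : (0 : ℝ) ≤ 3 * N)
        linarith
      have h3 := le_of_mul_le_mul_right h2 hlogpos
      rw [one_div, inv_mul_le_iff₀ (hd0 0)]
      linarith
    have hwt' : wt (fun i : Fin n => 1 / (d i.succ : ℝ)) e < N * (ε ^ 2 / 64) := by
      have h1 : wt (fun i : Fin n => 1 / (d i.succ : ℝ)) e =
          N * wt (fun i : Fin n => 1 / ((N * d i.succ : ℕ) : ℝ)) e := by
        rw [wt, wt, Finset.mul_sum]
        refine Finset.sum_congr rfl fun i _ => ?_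
        have := hd0 i.succ
        push_cast
        field_simp
      rw [h1]
      exact mul_lt_mul_of_pos_left hwt (by linarith)
    have h4 : (N : ℝ) * (3 * σ) ≤ N * (ε ^ 2 / 64) := by gcongr
    have h5 : 0 < (N : ℝ) * ε ^ 2 := by positivity
    linarith

end RothProof

namespace RothProof

section Counting

open Finset Real

lemma sum_exp_centered_le (d : ℕ) (hd : 1 ≤ d) (s : ℝ) :
    ∑ j : Fin (d + 1), exp (-s * ((j : ℕ) / d - 1 / 2)) ≤ (d + 1) * exp (s ^ 2 / 8) := by

  have hd' : (0 : ℝ) < d := by exact_mod_cast hd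
  have hrev : ∑ j : Fin (d + 1), exp (-s * ((j : ℕ) / d - 1 / 2)) =
      ∑ j : Fin (d + 1), exp (s * ((j : ℕ) / d - 1 / 2)) := by
    rw [← Equiv.sum_comp Fin.revPerm]
    refine sum_congr rfl fun j _ => ?_
    rw [Fin.revPerm_apply, Fin.val_rev, Nat.add_sub_add_right,
      Nat.cast_sub (Nat.lt_succ_iff.1 j.2)]
    congr 1
    field_simp
    ring
  have hcosh : ∑ j : Fin (d + 1), exp (-s * ((j : ℕ) / d - 1 / 2)) =
      ∑ j : Fin (d + 1), cosh (s * ((j : ℕ) / d - 1 / 2)) := by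
    have : ∑ j : Fin (d + 1), exp (-s * ((j : ℕ) / d - 1 / 2)) =
        (∑ j : Fin (d + 1), exp (s * ((j : ℕ) / d - 1 / 2)) +
          ∑ j : Fin (d + 1), exp (-s * ((j : ℕ) / d - 1 / 2))) / 2 := by
      rw [← hrev]
      ring
    rw [this, ← sum_add_distrib, sum_div]
    refine sum_congr rfl fun j _ => ?_
    rw [cosh_eq, neg_mul]
  rw [hcosh]
  calc ∑ j : Fin (d + 1), cosh (s * ((j : ℕ) / d - 1 / 2))
      ≤ ∑ _j : Fin (d + 1), exp (s ^ 2 / 8) := by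
        refine sum_le_sum fun j _ => (cosh_le_exp_half_sq _).trans (exp_le_exp.2 ?_)
        have h1 : ((j : ℕ) : ℝ) ≤ d := by exact_mod_cast Nat.lt_succ_iff.1 j.2
        have h2 : ((j : ℕ) : ℝ) / d ≤ 1 := (div_le_one hd').2 h1
        have h3 : (0 : ℝ) ≤ ((j : ℕ) : ℝ) / d := by positivity
        have h4 : (((j : ℕ) : ℝ) / d - 1 / 2) ^ 2 ≤ 1 / 4 := by nlinarith
        nlinarith [sq_nonneg s]
    _ = (d + 1) * exp (s ^ 2 / 8) := by simp

lemma card_sum_le_le {m : ℕ} (d : Fin m → ℕ) (η : ℝ) (hη : 0 ≤ η) (hd : ∀ h, 1 ≤ d h) :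
    (Fintype.card {j : ∀ h, Fin (d h + 1) // ∑ h, ((j h : ℕ) : ℝ) / d h ≤ m * (1 / 2 - η)} : ℝ) ≤
      (∏ h, ((d h : ℝ) + 1)) * exp (-(2 * η ^ 2 * m)) := by
  rw [Fintype.card_subtype, card_eq_sum_ones, Nat.cast_sum, sum_filter]
  calc ∑ j : ∀ h, Fin (d h + 1),
        (if ∑ h, ((j h : ℕ) : ℝ) / d h ≤ m * (1 / 2 - η) then ((1 : ℕ) : ℝ) else 0)
      ≤ ∑ j : ∀ h, Fin (d h + 1), exp (-(4 * η ^ 2 * m)) *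
          ∏ h, exp (-(4 * η) * ((j h : ℕ) / d h - 1 / 2)) := by
        refine sum_le_sum fun j _ => ?_
        rw [← exp_sum, ← exp_add]
        split_ifs with hj
        · rw [Nat.cast_one]
          refine one_le_exp ?_
          rw [← mul_sum, sum_sub_distrib]
          simp only [sum_const, card_univ, Fintype.card_fin, nsmul_eq_mul]
          nlinarith
        · exact exp_nonneg _
    _ = exp (-(4 * η ^ 2 * m)) * ∏ h, ∑ j : Fin (d h + 1),
          exp (-(4 * η) * ((j : ℕ) / d h - 1 / 2)) := by
        rw [← mul_sum, Fintype.prod_sum]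
    _ ≤ exp (-(4 * η ^ 2 * m)) * ∏ h, (((d h : ℝ) + 1) * exp ((4 * η) ^ 2 / 8)) := by
        gcongr with h
        exact sum_exp_centered_le _ (hd h) _
    _ = (∏ h, ((d h : ℝ) + 1)) * exp (-(2 * η ^ 2 * m)) := by
        rw [prod_mul_distrib, prod_const, card_univ, Fintype.card_fin, ← exp_nat_mul,
          mul_left_comm, ← exp_add]
        congr 2
        ring

end Counting

section Powers

open Polynomial

lemma exists_pow_reduction {α : ℝ} (hα : IsAlgebraic ℤ α) :
    ∃ D : ℕ, 1 ≤ D ∧ ∃ b : ℤ, b ≠ 0 ∧ ∃ C : ℝ, 1 ≤ C ∧ ∀ M k : ℕ, k ≤ M →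
      ∃ c : Fin D → ℤ, (b : ℝ) ^ M * α ^ k = ∑ l, c l * α ^ (l : ℕ) ∧ ∀ l, |(c l : ℝ)| ≤ C ^ M := by
  obtain ⟨f, hf, hfα⟩ := hα
  have hD : 1 ≤ f.natDegree := by
    by_contra h
    have h0 : f.natDegree = 0 := by omega
    rw [eq_C_of_natDegree_eq_zero h0, aeval_C] at hfα
    refine hf ?_
    rw [eq_C_of_natDegree_eq_zero h0]
    simpa using hfα
  set b := f.leadingCoeff with hb
  set A : ℝ := ∑ i ∈ f.support, |(f.coeff i : ℝ)|
  have hA : ∀ i, |(f.coeff i : ℝ)| ≤ A := by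
    intro i
    by_cases hi : i ∈ f.support
    · exact Finset.single_le_sum (f := fun i => |(f.coeff i : ℝ)|) (fun _ _ => abs_nonneg _) hi
    · rw [notMem_support_iff.1 hi]
      simpa using Finset.sum_nonneg fun i _ => abs_nonneg _
  have hA0 : 0 ≤ A := (abs_nonneg _).trans (hA 0)
  have hb0 : b ≠ 0 := leadingCoeff_ne_zero.2 hf
  set C : ℝ := |(b : ℝ)| + A + 1
  have hC : 1 ≤ C := by linarith [abs_nonneg (b : ℝ)]
  have key : ∀ k : ℕ, ∃ q : ℤ[X], (∀ i, f.natDegree ≤ i → q.coeff i = 0) ∧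
      (b : ℝ) ^ k * α ^ k = aeval α q ∧ ∀ i, |(q.coeff i : ℝ)| ≤ C ^ k := by
    intro k
    induction k with
    | zero =>
      refine ⟨1, fun i hi => ?_, by simp, fun i => ?_⟩
      · rw [coeff_one, if_neg (by omega)]
      · rw [coeff_one]
        split_ifs <;> simp
    | succ k ih =>
      obtain ⟨q, hq0, hqα, hqC⟩ := ih
      refine ⟨Polynomial.C b * (q * X) - Polynomial.C (q.coeff (f.natDegree - 1)) * f,
        fun i hi => ?_, ?_, fun i => ?_⟩
      · obtain ⟨i, rfl⟩ : ∃ i', i = i' + 1 := ⟨i - 1, by omega⟩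
        rw [coeff_sub, coeff_C_mul, coeff_C_mul, coeff_mul_X]
        rcases hi.eq_or_lt with h | h
        · rw [← h, show i = f.natDegree - 1 by omega, hb, leadingCoeff, mul_comm, sub_self]
        · rw [hq0 i (by omega), coeff_eq_zero_of_natDegree_lt h]
          simp
      · rw [map_sub, map_mul, map_mul, map_mul, aeval_X, hfα, mul_zero, sub_zero, ← hqα, aeval_C]
        simp only [algebraMap_int_eq, eq_intCast]
        ring
      · rw [coeff_sub, coeff_C_mul, coeff_C_mul]
        have h1 : |((q * X).coeff i : ℝ)| ≤ C ^ k := by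
          cases i with
          | zero => simpa using by positivity
          | succ i => rw [coeff_mul_X]; exact hqC i
        push_cast
        calc |(b : ℝ) * (q * X).coeff i - q.coeff (f.natDegree - 1) * f.coeff i|
            ≤ |(b : ℝ) * (q * X).coeff i| + |(q.coeff (f.natDegree - 1) : ℝ) * f.coeff i| :=
              abs_sub _ _
          _ ≤ |(b : ℝ)| * C ^ k + C ^ k * A := by
              rw [abs_mul, abs_mul]
              gcongr
              · exact hqC _
              · exact hA i
          _ ≤ C ^ (k + 1) := by
              have : 0 ≤ C ^ k := by positivity
              rw [pow_succ]
              nlinarith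
  refine ⟨f.natDegree, hD, b, hb0, C, hC, fun M k hk => ?_⟩
  obtain ⟨q, hq0, hqα, hqC⟩ := key k
  refine ⟨fun l => b ^ (M - k) * q.coeff l, ?_, fun l => ?_⟩
  · have hdeg : q.natDegree < f.natDegree := by
      rw [Nat.lt_iff_le_pred hD, natDegree_le_iff_coeff_eq_zero]
      exact fun i hi => hq0 i (by omega)
    rw [aeval_eq_sum_range' hdeg, ← Fin.sum_univ_eq_sum_range
      (fun i => q.coeff i • α ^ i)] at hqα
    calc (b : ℝ) ^ M * α ^ k = b ^ (M - k) * (b ^ k * α ^ k) := by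
          rw [← mul_assoc, ← pow_add, Nat.sub_add_cancel hk]
      _ = ∑ l : Fin f.natDegree, ((b ^ (M - k) * q.coeff l : ℤ) : ℝ) * α ^ (l : ℕ) := by
          rw [hqα, Finset.mul_sum]
          refine Finset.sum_congr rfl fun l _ => ?_
          rw [zsmul_eq_mul]
          push_cast
          ring
  · push_cast
    rw [abs_mul, abs_pow]
    calc |(b : ℝ)| ^ (M - k) * |(q.coeff l : ℝ)| ≤ C ^ (M - k) * C ^ k := by
          gcongr
          · linarith
          · exact hqC _
      _ = C ^ M := by rw [← pow_add, Nat.sub_add_cancel hk]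

end Powers

end RothProof

namespace RothProof

open MvPolynomial

section Auxiliary

attribute [local instance] Matrix.seminormedAddCommGroup

/-- A bounded exponent vector, as a finitely supported function. -/
noncomputable def boxExponent {m : ℕ} {d : Fin m → ℕ} (j : ∀ h, Fin (d h + 1)) : Fin m →₀ ℕ :=
  Finsupp.equivFunOnFinite.symm fun h => (j h : ℕ)

@[simp] lemma boxExponent_apply {m : ℕ} {d : Fin m → ℕ} (j : ∀ h, Fin (d h + 1)) (h : Fin m) :
    boxExponent j h = j h := rfl

lemma boxExponent_injective {m : ℕ} {d : Fin m → ℕ} :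
    Function.Injective (boxExponent : (∀ h, Fin (d h + 1)) → Fin m →₀ ℕ) := by
  intro j j' h
  funext i
  exact Fin.ext (DFunLike.congr_fun h i)

lemma exists_boxExponent_eq {m : ℕ} {d : Fin m → ℕ} (e : Fin m →₀ ℕ) (he : ∀ h, e h ≤ d h) :
    ∃ j : ∀ h, Fin (d h + 1), boxExponent j = e :=
  ⟨fun h => ⟨e h, Nat.lt_succ_of_le (he h)⟩, by ext; rfl⟩

/-- The polynomial with prescribed coefficients on a box of exponents. -/
noncomputable def boxPolynomial {m : ℕ} {d : Fin m → ℕ} {R : Type*} [CommRing R]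
    (t : (∀ h, Fin (d h + 1)) → R) : MvPolynomial (Fin m) R :=
  ∑ j, monomial (boxExponent j) (t j)

lemma coeff_boxPolynomial {m : ℕ} {d : Fin m → ℕ} {R : Type*} [CommRing R]
    (t : (∀ h, Fin (d h + 1)) → R) (j : ∀ h, Fin (d h + 1)) :
    coeff (boxExponent j) (boxPolynomial t) = t j := by
  classical
  rw [boxPolynomial, coeff_sum, Finset.sum_eq_single j]
  · simp
  · intro j' _ hj'
    rw [coeff_monomial, if_neg fun h => hj' (boxExponent_injective h)]
  · simp

lemma degreeOf_boxPolynomial_le {m : ℕ} {d : Fin m → ℕ} {R : Type*} [CommRing R]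
    (t : (∀ h, Fin (d h + 1)) → R) (i : Fin m) : degreeOf i (boxPolynomial t) ≤ d i := by
  classical
  rw [degreeOf_le_iff]
  intro e he
  rw [mem_support_iff, boxPolynomial, coeff_sum] at he
  obtain ⟨j, -, hj⟩ := Finset.exists_ne_zero_of_sum_ne_zero he
  rw [coeff_monomial] at hj
  have : boxExponent j = e := by
    by_contra h
    rw [if_neg h] at hj
    exact hj rfl
  rw [← this]
  exact Nat.lt_succ_iff.1 (j i).2

lemma coeff_shift_boxPolynomial {m : ℕ} {d : Fin m → ℕ} (t : (∀ h, Fin (d h + 1)) → ℤ) (α : ℝ)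
    (i : Fin m →₀ ℕ) :
    coeff i (shift (fun _ => α) (map (Int.castRingHom ℝ) (boxPolynomial t))) =
      ∑ j, (t j : ℝ) * (multichoose (boxExponent j) i *
        α ^ (∑ h, (j h : ℕ) - ∑ h, i h)) := by
  rw [boxPolynomial, map_sum, map_sum, coeff_sum]
  refine Finset.sum_congr rfl fun j _ => ?_
  rw [map_monomial, coeff_shift_monomial]
  by_cases h : i ≤ boxExponent j
  · have h1 : ∏ h, α ^ (boxExponent j h - i h) = α ^ (∑ h, (j h : ℕ) - ∑ h, i h) := by
      rw [Finset.prod_pow_eq_pow_sum]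
      congr 1
      have h2 : ∑ h', i h' + ∑ h', (boxExponent j h' - i h') = ∑ h', (j h' : ℕ) := by
        rw [← Finset.sum_add_distrib]
        exact Finset.sum_congr rfl fun h' _ => Nat.add_sub_cancel' (h h')
      omega
    rw [h1]
    simp
  · rw [multichoose_eq_zero h]
    simp

theorem exists_auxiliary_polynomial {α : ℝ} (hα : IsAlgebraic ℤ α) :
    ∃ D : ℕ, ∃ C : ℝ, 1 ≤ C ∧ ∀ (m : ℕ) (η : ℝ), 0 ≤ η → η ≤ 1 / 2 →
      2 * D * Real.exp (-(2 * η ^ 2 * m)) ≤ 1 → ∀ d : Fin m → ℕ, (∀ h, 1 ≤ d h) →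
      ∃ P : MvPolynomial (Fin m) ℤ, P ≠ 0 ∧ (∀ i, degreeOf i P ≤ d i) ∧
        l1 P ≤ C ^ ∑ i, d i ∧
        IndexGE (fun i => 1 / (d i : ℝ)) (m * (1 / 2 - η))
          (shift (fun _ => α) (map (Int.castRingHom ℝ) P)) := by
  classical
  obtain ⟨D, hD, b, hb, C, hC, H⟩ := exists_pow_reduction hα
  refine ⟨D, 8 * C, by linarith, fun m η hη hη' hm d hd => ?_⟩
  set M := ∑ i, d i
  let B := ∀ h, Fin (d h + 1)
  let J := {j : B // ∑ h, ((j h : ℕ) : ℝ) / d h ≤ m * (1 / 2 - η)}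
  have hM : ∀ (j : B) (i : B), ∑ h, (j h : ℕ) - ∑ h, boxExponent i h ≤ M := fun j i =>
    (Nat.sub_le _ _).trans (Finset.sum_le_sum fun h _ => Nat.lt_succ_iff.1 (j h).2)
  choose c hc hcC using fun (j i : B) => H M _ (hM j i)
  let A : Matrix (J × Fin D) B ℤ := Matrix.of fun i j =>
    multichoose (boxExponent j) (boxExponent i.1.1) * c j i.1.1 i.2
  have hcardB : (Fintype.card B : ℝ) = ∏ h, ((d h : ℝ) + 1) := by
    simp [B, Fintype.card_pi]
  have hcardB2 : (Fintype.card B : ℝ) ≤ 2 ^ M := by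
    rw [hcardB, ← Finset.prod_pow_eq_pow_sum]
    refine Finset.prod_le_prod (fun _ _ => by positivity) fun h _ => ?_
    exact_mod_cast Nat.lt_two_pow_self (n := d h)
  have hcardB0 : (0 : ℝ) < Fintype.card B := by
    rw [hcardB]
    positivity
  have hcardA : (2 * Fintype.card (J × Fin D) : ℝ) ≤ Fintype.card B := by
    rw [Fintype.card_prod, Fintype.card_fin]
    push_cast
    have h1 := card_sum_le_le d η hη hd
    rw [← hcardB] at h1
    calc 2 * ((Fintype.card J : ℝ) * D)
        ≤ 2 * ((Fintype.card B * Real.exp (-(2 * η ^ 2 * m))) * D) := by gcongr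
      _ = Fintype.card B * (2 * D * Real.exp (-(2 * η ^ 2 * m))) := by ring
      _ ≤ Fintype.card B * 1 := by gcongr
      _ = Fintype.card B := mul_one _
  have hlt : Fintype.card (J × Fin D) < Fintype.card B := by
    have : (Fintype.card (J × Fin D) : ℝ) < Fintype.card B := by linarith
    exact_mod_cast this
  have hpos : 0 < Fintype.card (J × Fin D) := by
    refine Fintype.card_pos_iff.2 ⟨⟨⟨fun _ => 0, ?_⟩, ⟨0, hD⟩⟩⟩
    simp only [Fin.val_zero, Nat.cast_zero, zero_div, Finset.sum_const_zero]
    have : (0 : ℝ) ≤ m := Nat.cast_nonneg _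
    nlinarith
  obtain ⟨t, ht0, htA, htnorm⟩ := Int.Matrix.exists_ne_zero_int_vec_norm_le A hlt hpos
  have hAnorm : ‖A‖ ≤ (2 * C) ^ M := by
    rw [Matrix.norm_le_iff (by positivity)]
    intro i j
    rw [Int.norm_eq_abs, mul_pow]
    simp only [A, Matrix.of_apply]
    push_cast
    rw [abs_mul, Nat.abs_cast]
    gcongr
    · exact_mod_cast multichoose_le _ _ d fun h => Nat.lt_succ_iff.1 (j h).2
    · exact hcC _ _ _
  have htbound : ‖t‖ ≤ (4 * C) ^ M := by
    have h1 : (1 : ℝ) ≤ (2 * C) ^ M := one_le_pow₀ (by linarith)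
    have hbase : (Fintype.card B : ℝ) * max 1 ‖A‖ ≤ (4 * C) ^ M := by
      calc (Fintype.card B : ℝ) * max 1 ‖A‖ ≤ 2 ^ M * (2 * C) ^ M := by
            gcongr
            exact max_le h1 hAnorm
        _ = (4 * C) ^ M := by rw [← mul_pow]; ring_nf
    have hbase1 : (1 : ℝ) ≤ Fintype.card B * max 1 ‖A‖ := by
      have h2 : (1 : ℝ) ≤ Fintype.card B := by exact_mod_cast (Nat.cast_pos.1 hcardB0)
      exact one_le_mul_of_one_le_of_one_le h2 (le_max_left _ _)
    refine htnorm.trans (le_trans ?_ hbase)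
    refine (Real.rpow_le_rpow_of_exponent_le hbase1 ?_).trans_eq (Real.rpow_one _)
    rw [div_le_one (by linarith)]
    linarith
  refine ⟨boxPolynomial t, ?_, degreeOf_boxPolynomial_le t, ?_, ?_⟩
  · intro h0
    refine ht0 (funext fun j => ?_)
    rw [← coeff_boxPolynomial t j, h0, coeff_zero, Pi.zero_apply]
  · calc l1 (boxPolynomial t) ≤ ∑ j, l1 (monomial (boxExponent j) (t j)) := l1_sum_le _ _
      _ ≤ ∑ _j : B, (4 * C) ^ M := Finset.sum_le_sum fun j _ => by
          rw [l1_monomial]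
          exact (norm_le_pi_norm t j).trans htbound
      _ = Fintype.card B * (4 * C) ^ M := by simp [B]
      _ ≤ 2 ^ M * (4 * C) ^ M := by gcongr
      _ = (8 * C) ^ M := by rw [← mul_pow]; ring_nf
  · intro i hi
    by_contra! hlt'
    refine hi ?_
    rw [coeff_shift_boxPolynomial]
    by_cases hid : ∀ h, i h ≤ d h
    · obtain ⟨i, rfl⟩ := exists_boxExponent_eq i hid
      have hiJ : ∑ h, ((i h : ℕ) : ℝ) / d h ≤ m * (1 / 2 - η) := by
        refine le_trans (le_of_eq ?_) hlt'.le
        rw [wt]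
        refine Finset.sum_congr rfl fun h _ => ?_
        rw [boxExponent_apply]
        ring
      have hb' : (b : ℝ) ^ M ≠ 0 := pow_ne_zero _ (by exact_mod_cast hb)
      refine (mul_eq_zero.1 (?_ : (b : ℝ) ^ M * _ = 0)).resolve_left hb'
      calc (b : ℝ) ^ M * ∑ j, (t j : ℝ) * (multichoose (boxExponent j) (boxExponent i) *
            α ^ (∑ h, (j h : ℕ) - ∑ h, boxExponent i h))
          = ∑ j, (t j : ℝ) * (multichoose (boxExponent j) (boxExponent i) *
              ∑ l, c j i l * α ^ (l : ℕ)) := by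
            rw [Finset.mul_sum]
            refine Finset.sum_congr rfl fun j _ => ?_
            rw [← hc j i]
            ring
        _ = ∑ l : Fin D, α ^ (l : ℕ) * ((A.mulVec t (⟨i, hiJ⟩, l) : ℤ) : ℝ) := by
            simp only [Matrix.mulVec, dotProduct, A, Matrix.of_apply, Finset.mul_sum]
            rw [Finset.sum_comm]
            refine Finset.sum_congr rfl fun l _ => ?_
            push_cast
            rw [Finset.mul_sum]
            refine Finset.sum_congr rfl fun j _ => ?_
            ring
        _ = 0 := by simp [htA]
    · push Not at hid
      obtain ⟨h, hh⟩ := hid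
      refine Finset.sum_eq_zero fun j _ => ?_
      rw [multichoose_eq_zero, Nat.cast_zero, zero_mul, mul_zero]
      intro hle
      have h1 := hle h
      have h2 := (j h).2
      rw [boxExponent_apply] at h1
      omega

end Auxiliary

section Estimates

variable {m : ℕ}

lemma degreeOf_shift_le {R : Type*} [CommRing R] (r : Fin m → R) (P : MvPolynomial (Fin m) R)
    (i : Fin m) (d : ℕ) (hd : degreeOf i P ≤ d) : degreeOf i (shift r P) ≤ d := by
  rw [degreeOf_le_iff] at hd ⊢
  intro e he
  rw [mem_support_iff, coeff_shift] at he
  obtain ⟨e', he', hne⟩ := Finset.exists_ne_zero_of_sum_ne_zero he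
  refine le_trans ?_ (hd e' he')
  by_contra h
  refine hne ?_
  rw [multichoose_eq_zero fun hle => h (hle i), Nat.cast_zero, zero_mul, mul_zero]

lemma one_le_abs_coeff_shift_mul (r : Fin m → ℚ) (P : MvPolynomial (Fin m) ℤ) (d : Fin m → ℕ)
    (hd : ∀ i, degreeOf i P ≤ d i) (e : Fin m →₀ ℕ)
    (he : coeff e (shift r (map (Int.castRingHom ℚ) P)) ≠ 0) :
    1 ≤ |coeff e (shift r (map (Int.castRingHom ℚ) P))| * ∏ i, ((r i).den : ℚ) ^ d i := by
  set c := coeff e (shift r (map (Int.castRingHom ℚ) P)) with hc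
  have hq : (0 : ℚ) < ∏ i, ((r i).den : ℚ) ^ d i :=
    Finset.prod_pos fun i _ => pow_pos (by exact_mod_cast (r i).den_pos) _
  have hz : ∃ z : ℤ, c * ∏ i, ((r i).den : ℚ) ^ d i = z := by
    rw [hc, coeff_shift, Finset.sum_mul]
    have hterm : ∀ e' ∈ (map (Int.castRingHom ℚ) P).support, ∃ z : ℤ,
        coeff e' (map (Int.castRingHom ℚ) P) * (multichoose e' e * ∏ i, r i ^ (e' i - e i)) *
          ∏ i, ((r i).den : ℚ) ^ d i = z := by
      intro e' he'
      refine ⟨coeff e' P * (multichoose e' e *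
        ∏ i, ((r i).num ^ (e' i - e i) * ((r i).den : ℤ) ^ (d i - (e' i - e i)))), ?_⟩
      have h1 : ∀ i, r i ^ (e' i - e i) * ((r i).den : ℚ) ^ d i =
          ((r i).num : ℚ) ^ (e' i - e i) * ((r i).den : ℚ) ^ (d i - (e' i - e i)) := by
        intro i
        have h2 : e' i - e i ≤ d i := (Nat.sub_le _ _).trans
          (degreeOf_le_iff.1 (hd i) e' (support_map_subset _ _ he'))
        conv_lhs => rw [← Nat.add_sub_of_le h2, pow_add, ← mul_assoc, ← mul_pow,
          Rat.mul_den_eq_num]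
      rw [coeff_map, mul_assoc, mul_assoc, ← Finset.prod_mul_distrib,
        Finset.prod_congr rfl fun i _ => h1 i]
      push_cast
      rfl
    choose! z hz using hterm
    exact ⟨∑ e' ∈ (map (Int.castRingHom ℚ) P).support, z e', by
      push_cast
      exact Finset.sum_congr rfl hz⟩
  obtain ⟨z, hz⟩ := hz
  have hz0 : z ≠ 0 := by
    rintro rfl
    rw [Int.cast_zero] at hz
    exact mul_ne_zero he hq.ne' hz
  rw [← abs_of_pos hq, ← abs_mul, hz]
  exact_mod_cast Int.one_le_abs hz0

lemma abs_coeff_shift_le (α w μ θ ε : ℝ) (hw : 0 ≤ w) (hμ : 0 ≤ μ) (r : Fin m → ℚ)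
    (d : Fin m → ℕ) (hd : ∀ i, 1 ≤ d i)
    (hr : ∀ i, |α - r i| ≤ Real.exp (-(μ * Real.log (r i).den)))
    (hdw : ∀ i, w ≤ d i * Real.log (r i).den) (P : MvPolynomial (Fin m) ℤ)
    (hdeg : ∀ i, degreeOf i P ≤ d i)
    (hidx : IndexGE (fun i => 1 / (d i : ℝ)) θ
      (shift (fun _ => α) (map (Int.castRingHom ℝ) P))) (e : Fin m →₀ ℕ)
    (he : wt (fun i => 1 / (d i : ℝ)) e ≤ ε) :
    |((coeff e (shift r (map (Int.castRingHom ℚ) P)) : ℚ) : ℝ)| ≤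
      (2 * (1 + |α|)) ^ (∑ i, d i) * l1 P * Real.exp (-(μ * (w * (θ - ε)))) := by
  set Q := shift (fun _ => α) (map (Int.castRingHom ℝ) P) with hQ
  have hmapdeg : ∀ i, degreeOf i (map (Int.castRingHom ℝ) P) ≤ d i := fun i =>
    degreeOf_le_iff.2 fun e he => degreeOf_le_iff.1 (hdeg i) e (support_map_subset _ _ he)
  have hQdeg : ∀ i, degreeOf i Q ≤ d i := fun i => degreeOf_shift_le _ _ _ _ (hmapdeg i)
  have hl1map : l1 (map (Int.castRingHom ℝ) P) = l1 P := by
    rw [l1_eq_sum (support_map_subset (Int.castRingHom ℝ) P), l1]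
    refine Finset.sum_congr rfl fun e _ => ?_
    rw [coeff_map, eq_intCast, Int.norm_eq_abs, Real.norm_eq_abs]
  have hQl1 : l1 Q ≤ (1 + |α|) ^ (∑ i, d i) * l1 P := by
    rw [← hl1map]
    exact l1_shift_le _ _ d hmapdeg _ fun _ => le_rfl
  have hcast : ((coeff e (shift r (map (Int.castRingHom ℚ) P)) : ℚ) : ℝ) =
      coeff e (shift (fun i => (r i : ℝ) - α) Q) := by
    rw [hQ, shift_shift, ← eq_ratCast (Rat.castHom ℝ), ← coeff_map, map_shift, map_map]
    congr 3
    ext i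
    simp
  rw [hcast, coeff_shift]
  refine (Finset.abs_sum_le_sum_abs _ _).trans ?_
  have hterm : ∀ e' ∈ Q.support, |coeff e' Q * (multichoose e' e *
      ∏ i, ((r i : ℝ) - α) ^ (e' i - e i))| ≤
        ‖coeff e' Q‖ * (2 ^ (∑ i, d i) * Real.exp (-(μ * (w * (θ - ε))))) := by
    intro e' he'
    rw [abs_mul, Real.norm_eq_abs]
    refine mul_le_mul_of_nonneg_left ?_ (abs_nonneg _)
    by_cases hle : e ≤ e'
    · rw [abs_mul, Nat.abs_cast, Finset.abs_prod]
      refine mul_le_mul ?_ ?_ (Finset.prod_nonneg fun _ _ => abs_nonneg _) (by positivity)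
      · exact_mod_cast multichoose_le e' e d fun i => degreeOf_le_iff.1 (hQdeg i) e' he'
      · calc ∏ i, |((r i : ℝ) - α) ^ (e' i - e i)|
            ≤ ∏ i, Real.exp (-(μ * (w * (1 / (d i : ℝ) * e' i - 1 / (d i : ℝ) * e i)))) := by
              refine Finset.prod_le_prod (fun _ _ => abs_nonneg _) fun i _ => ?_
              have hdi : (0 : ℝ) < d i := by exact_mod_cast hd i
              rw [abs_pow, abs_sub_comm]
              calc |α - r i| ^ (e' i - e i)
                  ≤ Real.exp (-(μ * Real.log (r i).den)) ^ (e' i - e i) := by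
                    gcongr
                    exact hr i
                _ = Real.exp (-(μ * (Real.log (r i).den * ((e' i - e i : ℕ) : ℝ)))) := by
                    rw [← Real.exp_nat_mul]
                    ring_nf
                _ ≤ _ := by
                    refine Real.exp_le_exp.2 (neg_le_neg (mul_le_mul_of_nonneg_left ?_ hμ))
                    rw [Nat.cast_sub (hle i), ← mul_sub, ← mul_assoc]
                    refine mul_le_mul_of_nonneg_right ?_
                      (sub_nonneg.2 (Nat.cast_le.2 (hle i)))
                    rw [mul_one_div, div_le_iff₀ hdi, mul_comm]
                    exact hdw i
          _ = Real.exp (-(μ * (w * (wt (fun i => 1 / (d i : ℝ)) e' -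
                wt (fun i => 1 / (d i : ℝ)) e)))) := by
              rw [← Real.exp_sum, Finset.sum_neg_distrib, ← Finset.mul_sum, ← Finset.mul_sum,
                Finset.sum_sub_distrib]
              rfl
          _ ≤ _ := by
              have := hidx e' (mem_support_iff.1 he')
              gcongr
    · rw [multichoose_eq_zero hle, Nat.cast_zero, zero_mul, abs_zero]
      positivity
  refine (Finset.sum_le_sum hterm).trans ?_
  rw [← Finset.sum_mul]
  calc l1 Q * (2 ^ (∑ i, d i) * Real.exp (-(μ * (w * (θ - ε)))))
      ≤ ((1 + |α|) ^ (∑ i, d i) * l1 P) *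
          (2 ^ (∑ i, d i) * Real.exp (-(μ * (w * (θ - ε))))) := by gcongr
    _ = _ := by rw [mul_pow]; ring

end Estimates

section Roth

lemma exists_lacunary_sequence (S : Set ℚ) (hS : ∀ B : ℕ, ∃ r ∈ S, B < r.den) (L R : ℝ)
    (hR : 1 ≤ R) :
    ∃ s : ℕ → ℚ, (∀ k, s k ∈ S) ∧ (∀ k, L ≤ Real.log (s k).den) ∧
      ∀ k l, k < l → R * Real.log (s k).den ≤ Real.log (s l).den := by
  have hf : ∀ T : ℝ, ∃ r ∈ S, T ≤ Real.log r.den := by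
    intro T
    obtain ⟨r, hr, hB⟩ := hS ⌈Real.exp T⌉₊
    refine ⟨r, hr, ?_⟩
    rw [Real.le_log_iff_exp_le (by exact_mod_cast r.den_pos)]
    exact (Nat.le_ceil _).trans (by exact_mod_cast hB.le)
  choose f hfS hf using hf
  let s : ℕ → ℚ := fun k => Nat.rec (f L) (fun _ r => f (max L (R * Real.log r.den))) k
  have hstep : ∀ k, R * Real.log (s k).den ≤ Real.log (s (k + 1)).den := fun k =>
    (le_max_right L _).trans (hf _)
  have hmono : Monotone fun k => Real.log (s k).den := monotone_nat_of_le_succ fun k =>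
    (le_mul_of_one_le_left (Real.log_natCast_nonneg _) hR).trans (hstep k)
  refine ⟨s, fun k => ?_, fun k => ?_, fun k l hkl => (hstep k).trans (hmono hkl)⟩
  · cases k <;> exact hfS _
  · cases k with
    | zero => exact hf L
    | succ k => exact (le_max_left L _).trans (hf _)

set_option maxHeartbeats 1000000 in
/-- **Roth's theorem**: for an algebraic number and an exponent greater than `2`, the
denominators of the approximations of that quality are bounded. -/
theorem roth {α : ℝ} (hα : IsAlgebraic ℤ α) {μ : ℝ} (hμ : 2 < μ) :
    ∃ B : ℕ, ∀ r : ℚ, |α - r| ≤ 1 / (r.den : ℝ) ^ μ → r.den ≤ B := by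
  by_contra! hcon
  obtain ⟨D, C, hC, haux⟩ := exists_auxiliary_polynomial hα
  obtain ⟨η, hη0, hη1, hη⟩ : ∃ η : ℝ, 0 < η ∧ η ≤ 1 / 4 ∧ 1 + η < μ * (1 / 2 - 2 * η) := by
    refine ⟨(μ - 2) / (4 * (2 * μ + 1)), by apply div_pos <;> linarith, ?_, ?_⟩
    · rw [div_le_iff₀ (by linarith)]
      linarith
    · have : (μ - 2) / (4 * (2 * μ + 1)) * (2 * μ + 1) = (μ - 2) / 4 := by
        field_simp
      nlinarith
  obtain ⟨m, hm⟩ := exists_nat_ge (max 1 (D / η ^ 2))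
  have hm1 : (1 : ℝ) ≤ m := (le_max_left _ _).trans hm
  have hmD : 2 * D * Real.exp (-(2 * η ^ 2 * m)) ≤ 1 := by
    have h1 : (D : ℝ) ≤ m * η ^ 2 :=
      (div_le_iff₀ (by positivity)).1 ((le_max_right _ _).trans hm)
    rw [Real.exp_neg, ← div_eq_mul_inv, div_le_one (Real.exp_pos _)]
    linarith [Real.add_one_le_exp (2 * η ^ 2 * m)]
  obtain ⟨σ, hσ0, hσ1, hroth⟩ := roth_lemma m η hη0 (by linarith)
  set G : ℝ := 2 * (1 + |α|) * C
  have hCG : C ≤ G := le_mul_of_one_le_left (by linarith) (by linarith [abs_nonneg α])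
  set K : ℝ := Real.log G + 1 with hK
  have hlogG : 0 ≤ Real.log G := Real.log_nonneg (hC.trans hCG)
  have hK1 : 1 ≤ K := by linarith
  have hGK : G ≤ Real.exp K := by
    rw [hK, Real.exp_add, Real.exp_log (by linarith)]
    exact le_mul_of_one_le_right (by linarith) (Real.one_le_exp (by norm_num))
  set κ := μ * (1 / 2 - 2 * η) - (1 + η) with hκ
  have hκ0 : 0 < κ := sub_pos.2 hη
  obtain ⟨L, hL1, hLσ, hLκ⟩ : ∃ L : ℝ, 1 ≤ L ∧ 2 * m * K ≤ σ * L ∧ 2 * K < κ * L := by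
    refine ⟨max 1 (max (2 * m * K / σ) (2 * K / κ + 1)), le_max_left _ _, ?_, ?_⟩
    · have := (le_max_left (2 * m * K / σ) (2 * K / κ + 1)).trans (le_max_right 1 _)
      rwa [div_le_iff₀' hσ0] at this
    · have := (le_max_right (2 * m * K / σ) (2 * K / κ + 1)).trans (le_max_right 1 _)
      rw [← div_lt_iff₀' hκ0]
      linarith
  obtain ⟨s, hsS, hsL, hsR⟩ := exists_lacunary_sequence
    {r | |α - r| ≤ 1 / (r.den : ℝ) ^ μ} (fun B => hcon B) L (2 / σ) (by
      rw [le_div_iff₀ hσ0]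
      linarith)
  let r : Fin m → ℚ := fun i => s (Fin.rev i)
  set q : Fin m → ℝ := fun i => Real.log (r i).den with hq
  have hqL : ∀ i, L ≤ q i := fun i => hsL _
  have hq0 : ∀ i, 0 < q i := fun i => by linarith [hqL i]
  have hqR : ∀ i j, i < j → 2 * q j ≤ σ * q i := by
    intro i j hij
    have := hsR (Fin.rev j) (Fin.rev i) (Fin.rev_lt_rev.2 hij)
    rwa [div_mul_eq_mul_div, div_le_iff₀' hσ0] at this
  set w : ℝ := (∑ i, q i) / η with hw
  have hqw : ∀ i, q i ≤ η * w := by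
    intro i
    rw [hw, mul_div_cancel₀ _ hη0.ne']
    exact Finset.single_le_sum (fun i _ => (hq0 i).le) (Finset.mem_univ i)
  have hmpos : 0 < m := by exact_mod_cast (zero_lt_one.trans_le hm1)
  have hw0 : 0 < w := by
    have h1 := hqw ⟨0, hmpos⟩
    have h2 := hq0 ⟨0, hmpos⟩
    exact pos_of_mul_pos_right (h2.trans_le h1) hη0.le
  let d : Fin m → ℕ := fun i => ⌈w / q i⌉₊
  have hd1 : ∀ i, 1 ≤ d i := fun i => Nat.one_le_ceil_iff.2 (div_pos hw0 (hq0 i))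
  have hdw : ∀ i, w ≤ d i * q i := fun i => (div_le_iff₀ (hq0 i)).1 (Nat.le_ceil _)
  have hdw' : ∀ i, d i * q i ≤ (1 + η) * w := by
    intro i
    have h1 : (d i : ℝ) < w / q i + 1 := Nat.ceil_lt_add_one (div_pos hw0 (hq0 i)).le
    have h2 : d i * q i ≤ (w / q i + 1) * q i := mul_le_mul_of_nonneg_right h1.le (hq0 i).le
    rw [add_mul, div_mul_cancel₀ _ (hq0 i).ne'] at h2
    linarith [hqw i]
  have hdL : ∀ i, L * d i ≤ 2 * w := by
    intro i
    have h1 : L * d i ≤ d i * q i := by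
      rw [mul_comm]
      exact mul_le_mul_of_nonneg_left (hqL i) (Nat.cast_nonneg _)
    have h2 := hdw' i
    nlinarith
  set M := ∑ i, d i
  have hM : L * M ≤ 2 * m * w := by
    rw [Nat.cast_sum, Finset.mul_sum]
    refine (Finset.sum_le_sum fun i _ => hdL i).trans (le_of_eq ?_)
    simp
    ring
  obtain ⟨P, hP0, hPdeg, hPl1, hPidx⟩ := haux m η hη0.le (by linarith) hmD d hd1
  have hPl1' : l1 P ≤ Real.exp (K * M) := by
    refine hPl1.trans ?_
    rw [mul_comm, Real.exp_nat_mul]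
    exact pow_le_pow_left₀ (by linarith) (hCG.trans hGK) _
  obtain ⟨e, he, hwt⟩ := hroth d r (K * M) P hP0 hd1
    (fun i j hij => by
      have h1 := hqR i j hij
      have h2 := hdw' i
      have h3 := hdw j
      have h4 : d i * (2 * q j) ≤ (σ * d j) * (2 * q j) := by
        calc d i * (2 * q j) ≤ d i * (σ * q i) :=
              mul_le_mul_of_nonneg_left h1 (Nat.cast_nonneg _)
          _ = σ * (d i * q i) := by ring
          _ ≤ σ * (2 * (d j * q j)) := by
              refine mul_le_mul_of_nonneg_left ?_ hσ0.le
              nlinarith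
          _ = _ := by ring
      exact le_of_mul_le_mul_right h4 (by linarith [hq0 j]))
    hPdeg hPl1'
    (by
      rw [← Nat.cast_sum]
      exact le_mul_of_one_le_left (Nat.cast_nonneg _) hK1)
    (fun i => by
      have h1 : L * (K * M) ≤ L * (σ * d i * q i) := by
        calc L * (K * M) = K * (L * M) := by ring
          _ ≤ K * (2 * m * w) := mul_le_mul_of_nonneg_left hM (by linarith)
          _ = (2 * m * K) * w := by ring
          _ ≤ (σ * L) * (d i * q i) := mul_le_mul hLσ (hdw i) hw0.le (by positivity)
          _ = _ := by ring
      exact le_of_mul_le_mul_left h1 (by linarith))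
  have hup := abs_coeff_shift_le α w μ (m * (1 / 2 - η)) η hw0.le (by linarith) r d hd1
    (fun i => by
      refine (hsS _).trans (le_of_eq ?_)
      rw [Real.exp_neg, Real.rpow_def_of_pos (by exact_mod_cast (r i).den_pos), one_div, mul_comm])
    hdw P hPdeg hPidx e hwt.le
  have hlow := one_le_abs_coeff_shift_mul r P d hPdeg e he
  set c := coeff e (shift r (map (Int.castRingHom ℚ) P))
  have hprod : (∏ i, ((r i).den : ℝ) ^ d i) ≤ Real.exp (m * ((1 + η) * w)) := by
    calc (∏ i, ((r i).den : ℝ) ^ d i) = ∏ i, Real.exp (d i * q i) := by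
          refine Finset.prod_congr rfl fun i _ => ?_
          rw [Real.exp_nat_mul, hq, Real.exp_log (by exact_mod_cast (r i).den_pos)]
      _ ≤ ∏ _i : Fin m, Real.exp ((1 + η) * w) :=
          Finset.prod_le_prod (fun _ _ => Real.exp_nonneg _)
            fun i _ => Real.exp_le_exp.2 (hdw' i)
      _ = _ := by simp [← Real.exp_nat_mul]
  have hlow' : (1 : ℝ) ≤ |(c : ℝ)| * ∏ i, ((r i).den : ℝ) ^ d i := by exact_mod_cast hlow
  have hpow : (2 * (1 + |α|)) ^ M * l1 P ≤ Real.exp (K * M) := by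
    calc (2 * (1 + |α|)) ^ M * l1 P ≤ (2 * (1 + |α|)) ^ M * C ^ M := by gcongr
      _ = G ^ M := (mul_pow _ _ _).symm
      _ ≤ Real.exp K ^ M := pow_le_pow_left₀ (by linarith) hGK _
      _ = Real.exp (K * M) := by rw [← Real.exp_nat_mul, mul_comm]
  have hfin : (1 : ℝ) ≤ Real.exp (K * M + -(μ * (w * (m * (1 / 2 - η) - η))) +
      m * ((1 + η) * w)) := by
    rw [Real.exp_add, Real.exp_add]
    refine hlow'.trans (mul_le_mul (hup.trans ?_) hprod (by positivity) (by positivity))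
    exact mul_le_mul_of_nonneg_right hpow (Real.exp_nonneg _)
  rw [Real.one_le_exp_iff] at hfin
  have h1 : μ * w * (m * (1 / 2 - 2 * η)) ≤ μ * w * (m * (1 / 2 - η) - η) :=
    mul_le_mul_of_nonneg_left (by nlinarith) (mul_pos (by linarith) hw0).le
  have h2 : κ * (m * w) ≤ K * M := by
    rw [hκ]
    linarith
  have h3 : K * (L * M) ≤ K * (2 * m * w) := mul_le_mul_of_nonneg_left hM (by linarith)
  have h4 : L * (κ * (m * w)) ≤ L * (K * M) := mul_le_mul_of_nonneg_left h2 (by linarith)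
  have h5 : 0 < m * w := by positivity
  linarith [mul_lt_mul_of_pos_right hLκ h5]

end Roth

/-- **Irrationality exponent of an algebraic number**: infinitely many approximations with
exponent greater than `2` force transcendence. -/
theorem transcendental_of_infinite_approxSet {α μ : ℝ} (hμ : 2 < μ)
    (h : (approxSet α μ).Infinite) : Transcendental ℚ α := by
  intro hα
  apply h
  obtain ⟨B, hB⟩ := roth ((IsFractionRing.isAlgebraic_iff ℤ ℚ ℝ).2 hα) hμ
  obtain ⟨δ, hδ0, hδ⟩ : ∃ δ : ℝ, 0 < δ ∧
      ∀ z : ℤ, 0 < |B.factorial * α - z| → δ ≤ |B.factorial * α - z| := by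
    by_cases hz : ∃ z : ℤ, B.factorial * α = z
    · obtain ⟨z, hz⟩ := hz
      refine ⟨1, one_pos, fun w hw => ?_⟩
      rw [hz] at hw ⊢
      exact_mod_cast hw
    · refine ⟨_, abs_pos.2 (sub_ne_zero.2 fun h => hz ⟨_, h⟩), fun w _ => round_le _ w⟩
  have hN : (0 : ℝ) < B.factorial := by exact_mod_cast B.factorial_pos
  have hbound : ∀ P Q : ℤ, (P, Q) ∈ approxSet α μ →
      (Q : ℝ) ≤ B.factorial / δ ∧ |(P : ℝ)| ≤ (|α| + 1) * (B.factorial / δ) := by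
    rintro P Q ⟨hQ, hpos, hlt⟩
    dsimp only at hQ hpos hlt
    have hQ1 : (1 : ℝ) ≤ Q := by exact_mod_cast hQ
    have hQ0 : (0 : ℝ) < Q := by linarith
    set r : ℚ := (P : ℚ) / (Q : ℚ) with hr
    have hrc : (r : ℝ) = (P : ℝ) / (Q : ℝ) := by rw [hr]; push_cast; rfl
    have hden : (r.den : ℝ) ≤ Q := by
      have h1 : (r.den : ℤ) ∣ Q := by
        rw [hr, ← Rat.divInt_eq_div]
        exact Rat.den_dvd P Q
      exact_mod_cast Int.le_of_dvd (by linarith) h1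
    have hden0 : (0 : ℝ) < r.den := by exact_mod_cast r.den_pos
    rw [← hrc] at hpos hlt
    have hrB : r.den ≤ B := hB r (hlt.le.trans
      (one_div_le_one_div_of_le (Real.rpow_pos_of_pos hden0 _)
        (Real.rpow_le_rpow hden0.le hden (by linarith))))
    obtain ⟨t, ht⟩ := Nat.dvd_factorial r.den_pos hrB
    have hInt : (B.factorial : ℝ) * r = ((t * r.num : ℤ) : ℝ) := by
      have h2 : (r.den : ℝ) * r = r.num := by
        exact_mod_cast (mul_comm _ _).trans (Rat.mul_den_eq_num r)
      rw [ht]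
      push_cast
      rw [← h2]
      ring
    have habs : |B.factorial * α - ((t * r.num : ℤ) : ℝ)| = B.factorial * |α - r| := by
      rw [← hInt, ← mul_sub, abs_mul, abs_of_pos hN]
    have h3 : δ ≤ B.factorial * |α - r| :=
      (hδ _ (by rw [habs]; positivity)).trans_eq habs
    have hle : |α - r| < 1 / Q := hlt.trans_le
      (one_div_le_one_div_of_le hQ0 (by
        simpa using Real.rpow_le_rpow_of_exponent_le hQ1 (by linarith : (1 : ℝ) ≤ μ)))
    have hQle : (Q : ℝ) ≤ B.factorial / δ := by
      rw [le_div_iff₀ hδ0]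
      have h4 : δ ≤ B.factorial * (1 / Q) :=
        h3.trans (mul_le_mul_of_nonneg_left hle.le hN.le)
      rw [mul_one_div, le_div_iff₀ hQ0] at h4
      linarith
    refine ⟨hQle, ?_⟩
    have h5 : |(r : ℝ)| ≤ |α| + 1 := by
      have h6 : |α - r| ≤ 1 := hle.le.trans ((div_le_one hQ0).2 hQ1)
      have h7 := abs_sub_abs_le_abs_sub (r : ℝ) α
      rw [abs_sub_comm] at h7
      linarith
    have h8 : |(P : ℝ)| = |(r : ℝ)| * Q := by
      rw [hrc, abs_div, abs_of_pos hQ0, div_mul_cancel₀ _ hQ0.ne']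
    rw [h8]
    exact mul_le_mul h5 hQle hQ0.le (by positivity)
  refine ((Set.finite_Icc (-⌈(|α| + 1) * (B.factorial / δ)⌉) ⌈(|α| + 1) * (B.factorial / δ)⌉).prod
    (Set.finite_Icc 1 ⌈B.factorial / δ⌉)).subset ?_
  rintro ⟨P, Q⟩ hPQ
  obtain ⟨h1, h2⟩ := hbound P Q hPQ
  have h3 : |P| ≤ ⌈(|α| + 1) * (B.factorial / δ)⌉ := by
    exact_mod_cast h2.trans (Int.le_ceil _)
  exact ⟨abs_le.1 h3, hPQ.1, by exact_mod_cast h1.trans (Int.le_ceil _)⟩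

/-- A partial sum of an alternating series with strictly decreasing terms differs from the sum
by a nonzero amount, at most the first omitted term. -/
lemma abs_alternating_series_sub_pos_and_le {f : ℕ → ℝ} {l : ℝ} (hf : StrictAnti f)
    (hl : Filter.Tendsto (fun n => ∑ i ∈ Finset.range n, (-1) ^ i * f i) Filter.atTop (nhds l))
    (n : ℕ) :
    0 < |l - ∑ i ∈ Finset.range n, (-1) ^ i * f i| ∧
      |l - ∑ i ∈ Finset.range n, (-1) ^ i * f i| ≤ f n := by
  have hlo := fun k => hf.antitone.alternating_series_le_tendsto hl k
  have hup := fun k => hf.antitone.tendsto_le_alternating_series hl k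
  obtain ⟨k, rfl | rfl⟩ := n.even_or_odd'
  · have h1 := hlo (k + 1)
    have h2 := hup k
    have h3 := hf (Nat.lt_succ_self (2 * k))
    rw [mul_add, mul_one, Finset.sum_range_succ, Finset.sum_range_succ] at h1
    rw [Finset.sum_range_succ] at h2
    simp only [pow_succ, pow_mul] at h1 h2 ⊢
    norm_num at h1 h2 h3 ⊢
    refine ⟨fun h => by linarith, abs_le.2 ⟨by linarith, by linarith⟩⟩
  · have h1 := hup (k + 1)
    have h2 := hlo (k + 1)
    have h3 := hf (Nat.lt_succ_self (2 * k + 1))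
    rw [mul_add, mul_one, Finset.sum_range_succ, Finset.sum_range_succ] at h1
    rw [mul_add, mul_one, Finset.sum_range_succ] at h2
    generalize ∑ i ∈ Finset.range (2 * k + 1), (-1) ^ i * f i = S at h1 h2 ⊢
    simp only [pow_succ, pow_mul] at h1 h2
    norm_num at h1 h2 h3 ⊢
    refine ⟨fun h => by linarith, abs_le.2 ⟨by linarith, by linarith⟩⟩

/-- The coupled recursion `X' = X + Y`, `Y' ≥ Y + X'` forces `X'` to exceed `c * X` by an
unbounded amount as soon as `c` is below the square of the golden ratio. -/
lemma eventually_mul_lt_succ {X Y : ℕ → ℝ} (hX0 : 0 ≤ X 0) (hY0 : 0 ≤ Y 0)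
    (hX : ∀ n, X (n + 1) = X n + Y n) (hY : ∀ n, Y n + X (n + 1) ≤ Y (n + 1))
    (hlim : Filter.Tendsto X Filter.atTop Filter.atTop) {c : ℝ}
    (hc : c < (3 + Real.sqrt 5) / 2) :
    ∀ᶠ n in Filter.atTop, c * X n < X (n + 1) := by
  set g := Real.goldenRatio
  have hg : g ^ 2 = g + 1 := Real.goldenRatio_sq
  have hg1 : 1 < g := Real.one_lt_goldenRatio
  have hg2 : g < 2 := Real.goldenRatio_lt_two
  have hcg : c < 1 + g := by
    simp only [g, Real.goldenRatio]
    linarith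
  have hZ : ∀ n, -(g * X 0) ≤ Y n - g * X n := by
    intro n
    induction n with
    | zero => linarith
    | succ n ih =>
      have h1 : (2 - g) * (Y n - g * X n) ≤ Y (n + 1) - g * X (n + 1) := by
        have h2 := hY n
        rw [hX] at h2 ⊢
        linear_combination h2 + X n * hg
      have h3 : (2 - g) * -(g * X 0) ≤ (2 - g) * (Y n - g * X n) :=
        mul_le_mul_of_nonneg_left ih (by linarith)
      have h4 : 0 ≤ (g - 1) * (g * X 0) :=
        mul_nonneg (by linarith) (mul_nonneg (by linarith) hX0)
      linarith
  filter_upwards [(hlim.const_mul_atTop (sub_pos.2 hcg)).eventually_gt_atTop (g * X 0)] with n hn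
  have := hZ n
  rw [hX]
  linarith

end RothProof

/-- **Corollary 3.2 (Pierce-subtracted case).**  The number `α = p/q - ∑_{j≥2} (-1)^j/x_j` of
Theorem 2.3 is transcendental, and its irrationality exponent is at least `(3 + √5)/2`: for
every `μ < (3 + √5)/2` there are infinitely many rationals `P/Q` with
`0 < |α - P/Q| < 1/Q^μ`. -/
theorem pierce_subtracted_transcendental
    (k : ℕ) (a : ℕ → ℤ) (ha : ∀ j, 1 ≤ j → j ≤ 2 * k + 1 → 1 ≤ a j)
    (pc qc : ℕ → ℤ)
    (hpc0 : pc 0 = 0) (hpc1 : pc 1 = 1) (hqc0 : qc 0 = 1) (hqc1 : qc 1 = 0)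
    (hpc : ∀ n, pc (n + 2) = a n * pc (n + 1) + pc n)
    (hqc : ∀ n, qc (n + 2) = a n * qc (n + 1) + qc n)
    (p q : ℤ) (hq : 1 < q) (hcop : Int.gcd p q = 1)
    (hp : p = pc (2 * k + 3)) (hqv : q = qc (2 * k + 3))
    (m : ℤ) (hm : 0 ≤ m) (hm1 : qc (2 * k + 2) = 1 → 1 ≤ m)
    (u x y : ℕ → ℤ) (hu : ∀ n, 1 ≤ n → 1 ≤ u n)
    (hx1 : x 1 = q) (hy0 : y 0 = m * q + qc (2 * k + 2) - 1)
    (hrec : ∀ j, 1 ≤ j → y j = y (j - 1) * (1 + u j * x j) ∧ x (j + 1) = x j * y j)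
    (α : ℝ) (hα : α = (p : ℝ) / (q : ℝ) - ∑' j : ℕ, (-1 : ℝ) ^ j / (x (j + 2) : ℝ)) :
    Transcendental ℚ α ∧
      ∀ μ : ℝ, μ < (3 + Real.sqrt 5) / 2 → (approxSet α μ).Infinite := by
  have hqcpos : ∀ n, n ≤ 2 * k + 1 → 0 ≤ qc (n + 1) ∧ 1 ≤ qc (n + 2) := by
    intro n
    induction n with
    | zero => simp [hqc, hqc0, hqc1]
    | succ n ih =>
      intro hn
      obtain ⟨h1, h2⟩ := ih (by omega)
      have h3 := ha (n + 1) (by omega) hn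
      refine ⟨by linarith, ?_⟩
      rw [hqc (n + 1)]
      nlinarith
  have hy0pos : 1 ≤ y 0 := by
    have h1 := (hqcpos (2 * k) (by omega)).2
    rcases h1.eq_or_lt with h2 | h2
    · have := hm1 h2.symm
      rw [hy0]
      nlinarith
    · rw [hy0]
      nlinarith
  have hy : ∀ n, y (n + 1) = y n * (1 + u (n + 1) * x (n + 1)) := fun n => by
    simpa using (hrec (n + 1) (by omega)).1
  have hx : ∀ n, x (n + 2) = x (n + 1) * y (n + 1) := fun n => (hrec (n + 1) (by omega)).2
  have hpos : ∀ n, 2 ≤ x (n + 1) ∧ 1 ≤ y n := by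
    intro n
    induction n with
    | zero => exact ⟨by rw [hx1]; omega, hy0pos⟩
    | succ n ih =>
      have h1 := hu (n + 1) (by omega)
      have h2 : 1 ≤ y (n + 1) := by
        rw [hy]
        have : 1 ≤ u (n + 1) * x (n + 1) := by nlinarith
        nlinarith
      exact ⟨by rw [hx]; nlinarith, h2⟩
  have hyx : ∀ n, y n * x (n + 1) < y (n + 1) := by
    intro n
    have h1 := hu (n + 1) (by omega)
    obtain ⟨h2, h3⟩ := hpos n
    rw [hy]
    refine mul_lt_mul_of_pos_left ?_ (by omega)
    nlinarith
  have hxx : ∀ n, 2 * x (n + 1) ≤ x (n + 2) := by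
    intro n
    obtain ⟨h2, h3⟩ := hpos n
    have h4 : 2 ≤ y (n + 1) := by nlinarith [hyx n]
    rw [hx]
    nlinarith
  have hxpos : ∀ n, (0 : ℝ) < x (n + 1) := fun n => by
    have := (hpos n).1
    exact_mod_cast (by omega : 0 < x (n + 1))
  have hypos : ∀ n, (0 : ℝ) < y n := fun n => by
    have := (hpos n).2
    exact_mod_cast (by omega : 0 < y n)
  have hxpow : ∀ n, (2 : ℝ) ^ n ≤ x (n + 1) := by
    intro n
    induction n with
    | zero => exact_mod_cast (by linarith [(hpos 0).1] : 1 ≤ x 1)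
    | succ n ih =>
      have : (2 : ℝ) * x (n + 1) ≤ x (n + 2) := by exact_mod_cast hxx n
      rw [pow_succ]
      linarith
  have hxmono : StrictMono fun n => x (n + 1) := strictMono_nat_of_lt_succ fun n => by
    have h1 := hxx n
    have h2 := (hpos n).1
    show x (n + 1) < x (n + 2)
    omega
  have hanti : StrictAnti fun j => 1 / (x (j + 2) : ℝ) := fun i j hij =>
    one_div_lt_one_div_of_lt (hxpos _) (by exact_mod_cast hxmono (Nat.succ_lt_succ hij))
  have hsum : Summable fun j : ℕ => (-1 : ℝ) ^ j * (1 / (x (j + 2) : ℝ)) := by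
    refine Summable.of_norm_bounded (summable_geometric_of_lt_one (by norm_num)
      (by norm_num : (1 / 2 : ℝ) < 1)) fun j => ?_
    rw [norm_mul, norm_pow, norm_neg, norm_one, one_pow, one_mul, Real.norm_of_nonneg
      (one_div_nonneg.2 (hxpos (j + 1)).le), one_div_pow]
    refine one_div_le_one_div_of_le (by positivity) ((pow_le_pow_right₀ (by norm_num)
      j.le_succ).trans (hxpow (j + 1)))
  have hInt : ∀ n, ∃ P : ℤ, (p : ℝ) / q -
      ∑ j ∈ Finset.range n, (-1 : ℝ) ^ j * (1 / (x (j + 2) : ℝ)) = P / x (n + 1) := by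
    intro n
    induction n with
    | zero => exact ⟨p, by simp [hx1]⟩
    | succ n ih =>
      obtain ⟨P, hP⟩ := ih
      refine ⟨P * y (n + 1) - (-1) ^ n, ?_⟩
      have h1 := (hxpos n).ne'
      have h2 := (hypos (n + 1)).ne'
      rw [Finset.sum_range_succ, ← sub_sub, hP, hx]
      push_cast
      field_simp
  choose P hP using hInt
  have happrox : ∀ n, 0 < |α - P n / x (n + 1)| ∧
      |α - P n / x (n + 1)| ≤ 1 / (x (n + 2) : ℝ) := by
    intro n
    have h1 := RothProof.abs_alternating_series_sub_pos_and_le hanti hsum.hasSum.tendsto_sum_nat n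
    rw [← hP, hα, abs_sub_comm]
    simpa [div_eq_mul_inv] using h1
  have hmain : ∀ μ : ℝ, μ < (3 + Real.sqrt 5) / 2 → (approxSet α μ).Infinite := by
    intro μ hμ
    have hlog : Filter.Tendsto (fun n => Real.log (x (n + 1))) Filter.atTop Filter.atTop :=
      Real.tendsto_log_atTop.comp (Filter.tendsto_atTop_mono hxpow
        (tendsto_pow_atTop_atTop_of_one_lt one_lt_two))
    have hev := RothProof.eventually_mul_lt_succ (X := fun n => Real.log (x (n + 1)))
      (Y := fun n => Real.log (y (n + 1)))
      (Real.log_nonneg (by exact_mod_cast (by linarith [(hpos 0).1] : 1 ≤ x 1)))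
      (Real.log_nonneg (by exact_mod_cast (hpos 1).2))
      (fun n => by
        rw [hx]
        push_cast
        exact Real.log_mul (hxpos n).ne' (hypos (n + 1)).ne')
      (fun n => by
        rw [← Real.log_mul (hypos (n + 1)).ne' (hxpos (n + 1)).ne']
        exact Real.log_le_log (mul_pos (hypos _) (hxpos _)) (by exact_mod_cast (hyx (n + 1)).le))
      hlog hμ
    obtain ⟨N, hN⟩ := Filter.eventually_atTop.1 hev
    refine Set.infinite_of_injective_forall_mem (f := fun n => (P (n + N), x (n + N + 1)))
      (fun i j hij => ?_) fun n => ?_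
    · have := hxmono.injective (Prod.ext_iff.1 hij).2
      omega
    · obtain ⟨h1, h2⟩ := happrox (n + N)
      refine ⟨by linarith [(hpos (n + N)).1], h1, h2.trans_lt ?_⟩
      refine one_div_lt_one_div_of_lt (Real.rpow_pos_of_pos (hxpos _) _) ?_
      rw [Real.rpow_def_of_pos (hxpos _), mul_comm]
      exact (Real.lt_log_iff_exp_lt (hxpos _)).1 (hN (n + N) (by omega))
  refine ⟨RothProof.transcendental_of_infinite_approxSet (μ := 5 / 2) (by norm_num) (hmain _ ?_), hmain⟩
  have : (2 : ℝ) < Real.sqrt 5 := Real.lt_sqrt_of_sq_lt (by norm_num)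
  linarith
end

section
/- Suppose that the sequence (u_n) is given by u_n = Σ_{j=0}^{d−1} v_n^{(j)}·x_n^{d−1−j}, where d ≥ 1 is an integer, each (v_n^{(j)}) is an integer sequence with v_n^{(0)} ≥ 1 for all n and u_n ≥ 1 for all n, and as n → ∞ one has log v_n^{(0)} = O(ν^n) for some ν < λ and v_n^{(j)} = O(v_n^{(0)}) for j = 1, …, d−1, where λ = (d + 2 + √(d(d+4)))/2. Then α = p/q + Σ_{j=2}^∞ 1/x_j has irrationality exponent μ(α) = λ. -/
open Filter Topology

/-- A sequence obeying a perturbed recurrence `X (n+2) = c X (n+1) - X n + e n`, whose perturbation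
grows slower than `lam ^ n` for the dominant characteristic root `lam`, has ratios tending
to `lam`. -/
lemma eventually_abs_sub_mul_le_of_recurrence {X e : ℕ → ℝ} {lam c ν K C : ℝ} {N : ℕ}
    (hlam : 2 ≤ lam) (hchar : lam ^ 2 = c * lam - 1) (hν1 : 1 ≤ ν) (hν : ν < lam) (hC : 0 ≤ C)
    (hrec : ∀ n, N ≤ n → X (n + 2) = c * X (n + 1) - X n + e n)
    (he : ∀ n, N ≤ n → |e n| ≤ K * ν ^ n) (heC : ∀ n, N ≤ n → -C ≤ e n)
    (hmono : ∀ n, N ≤ n → X n ≤ X (n + 1)) (hpos : ∀ n, N ≤ n → 0 ≤ X n)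
    (hX : Tendsto X atTop atTop) {ε : ℝ} (hε : 0 < ε) :
    ∀ᶠ n in atTop, |X (n + 1) - lam * X n| ≤ ε * X n := by
  have hl0 : 0 < lam := by linarith
  obtain ⟨n0, hn0, hn0N⟩ : ∃ n0, 2 * (C + 1) ≤ X (n0 + 1) ∧ N ≤ n0 :=
    (((tendsto_add_atTop_iff_nat 1).2 hX).eventually_ge_atTop (2 * (C + 1))
      |>.and (eventually_ge_atTop N)).exists
  have hinv : lam⁻¹ ≤ 1 / 2 := by
    rw [inv_le_comm₀ hl0 (by norm_num)]; simpa using hlam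
  have hinv0 : 0 < lam⁻¹ := inv_pos.2 hl0
  have hc : c = lam + lam⁻¹ := by field_simp; linarith
  have hll : lam * lam⁻¹ = 1 := mul_inv_cancel₀ hl0.ne'
  have hZ : ∀ i, C + lam ^ i ≤ X (n0 + i + 1) - lam⁻¹ * X (n0 + i) := by
    intro i
    induction i with
    | zero =>
      have h1 := hmono n0 hn0N
      have h2 := hpos n0 hn0N
      simp only [pow_zero, add_zero]
      nlinarith
    | succ i ih =>
      have h1 := hrec (n0 + i) (by omega)
      have h2 := heC (n0 + i) (by omega)
      have h3 : X (n0 + (i + 1) + 1) - lam⁻¹ * X (n0 + (i + 1))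
          = lam * (X (n0 + i + 1) - lam⁻¹ * X (n0 + i)) + e (n0 + i) := by
        rw [show n0 + (i + 1) + 1 = n0 + i + 2 by ring, show n0 + (i + 1) = n0 + i + 1 by ring, h1, hc]
        linear_combination X (n0 + i) * hll
      rw [h3, pow_succ]
      nlinarith [mul_le_mul_of_nonneg_left ih hl0.le]
  have hXlow : ∀ i, lam ^ i ≤ X (n0 + i + 1) := by
    intro i
    have h1 := hZ i
    have h2 := mul_nonneg hinv0.le (hpos (n0 + i) (by omega))
    linarith
  set M := max |X (n0 + 1) - lam * X n0| (2 * (K * ν ^ n0)) with hM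
  have hν0 : 0 < ν := by linarith
  have hM0 : 0 ≤ M := le_trans (abs_nonneg _) (le_max_left _ _)
  have hD : ∀ i, |X (n0 + i + 1) - lam * X (n0 + i)| ≤ M * ν ^ i := by
    intro i
    induction i with
    | zero => simp [hM]
    | succ i ih =>
      have h1 := hrec (n0 + i) (by omega)
      have h2 := he (n0 + i) (by omega)
      have h3 : X (n0 + (i + 1) + 1) - lam * X (n0 + (i + 1))
          = lam⁻¹ * (X (n0 + i + 1) - lam * X (n0 + i)) + e (n0 + i) := by
        rw [show n0 + (i + 1) + 1 = n0 + i + 2 by ring, show n0 + (i + 1) = n0 + i + 1 by ring, h1, hc]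
        linear_combination X (n0 + i) * hll
      rw [h3]
      have h4 : |lam⁻¹ * (X (n0 + i + 1) - lam * X (n0 + i))| ≤ 1 / 2 * (M * ν ^ i) := by
        rw [abs_mul, abs_of_pos hinv0]
        exact mul_le_mul hinv ih (abs_nonneg _) (by norm_num)
      have h5 : 2 * (K * ν ^ n0) ≤ M := le_max_right _ _
      have h6 : 0 < ν ^ i := pow_pos hν0 i
      have h7 := abs_add_le (lam⁻¹ * (X (n0 + i + 1) - lam * X (n0 + i))) (e (n0 + i))
      have h8 : K * ν ^ (n0 + i) ≤ 1 / 2 * (M * ν ^ i) := by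
        rw [pow_add]
        nlinarith [mul_le_mul_of_nonneg_right h5 h6.le]
      have h9 : M * ν ^ i ≤ M * ν ^ (i + 1) := by
        exact mul_le_mul_of_nonneg_left (pow_le_pow_right₀ hν1 (by omega)) hM0
      linarith
  have hlim : Tendsto (fun i : ℕ => M * ν * (ν / lam) ^ i) atTop (𝓝 (M * ν * 0)) :=
    (tendsto_pow_atTop_nhds_zero_of_lt_one (by positivity) ((div_lt_one hl0).2 hν)).const_mul _
  rw [mul_zero] at hlim
  obtain ⟨i0, hi0⟩ := eventually_atTop.1 (hlim.eventually_le_const hε)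
  filter_upwards [eventually_ge_atTop (n0 + i0 + 1)] with n hn
  obtain ⟨i, rfl⟩ : ∃ i, n = n0 + i + 1 := ⟨n - n0 - 1, by omega⟩
  have h1 := hi0 i (by omega)
  have h2 := hD (i + 1)
  rw [div_pow, ← mul_div_assoc, div_le_iff₀ (by positivity)] at h1
  calc |X (n0 + i + 1 + 1) - lam * X (n0 + i + 1)| ≤ M * ν ^ (i + 1) := h2
    _ = M * ν * ν ^ i := by ring
    _ ≤ ε * lam ^ i := h1
    _ ≤ ε * X (n0 + i + 1) := by gcongr; exact hXlow i

/-- The tails of a series of reciprocals of an at least doubling sequence. -/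
lemma tsum_inv_tail_bounds {f : ℕ → ℝ} (hf : ∀ n, 0 < f n) (h2 : ∀ n, 2 * f n ≤ f (n + 1)) :
    Summable (fun j => 1 / f j) ∧
      ∀ N, 1 / f N ≤ ∑' j, 1 / f (j + N) ∧ ∑' j, 1 / f (j + N) ≤ 2 / f N := by
  have hgeo : ∀ N j, 1 / f (j + N) ≤ 1 / f N * (1 / 2) ^ j := by
    intro N j
    induction j with
    | zero => simp
    | succ j ih =>
      have h := h2 (j + N)
      have h' := hf (j + N)
      calc 1 / f (j + 1 + N) ≤ 1 / (2 * f (j + N)) := by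
            rw [show j + 1 + N = j + N + 1 by ring]
            exact one_div_le_one_div_of_le (by positivity) h
        _ = 1 / f (j + N) * (1 / 2) := by field_simp
        _ ≤ 1 / f N * (1 / 2) ^ j * (1 / 2) := by gcongr
        _ = _ := by ring
  have hgs : ∀ N, HasSum (fun j : ℕ => 1 / f N * (1 / 2) ^ j) (1 / f N * 2) :=
    fun N => hasSum_geometric_two.mul_left _
  have hs : ∀ N, Summable (fun j => 1 / f (j + N)) := fun N =>
    Summable.of_nonneg_of_le (fun j => (one_div_pos.2 (hf _)).le) (hgeo N) (hgs N).summable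
  refine ⟨by simpa using hs 0, fun N => ⟨?_, ?_⟩⟩
  · simpa using (hs N).le_tsum 0 (fun j _ => (one_div_pos.2 (hf _)).le)
  · calc _ ≤ ∑' j : ℕ, 1 / f N * (1 / 2) ^ j := (hs N).tsum_le_tsum (hgeo N) (hgs N).summable
      _ = 2 / f N := by rw [(hgs N).tsum_eq]; ring

/-- Rational approximations `P n / B n`, together with an error of order exactly `1 / B (n+1)`,
where `B (n+1)` grows like `B n ^ lam`, give approximations of every exponent below `lam`. -/
lemma infinite_approxSet {α lam : ℝ} {P B : ℕ → ℤ} (hB : ∀ n, 1 ≤ B n)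
    (hlow : ∀ n, 1 / (B (n + 1) : ℝ) ≤ α - P n / B n)
    (hupp : ∀ n, α - P n / B n ≤ 2 / (B (n + 1) : ℝ)) (hBmono : StrictMono B)
    (hlog : Tendsto (fun n => Real.log (B n)) atTop atTop)
    (hratio : ∀ ε : ℝ, 0 < ε →
      ∀ᶠ n in atTop, |Real.log (B (n + 1)) - lam * Real.log (B n)| ≤ ε * Real.log (B n))
    {μ : ℝ} (hμ : μ < lam) : (approxSet α μ).Infinite := by
  have hBR : ∀ n, (0 : ℝ) < B n := fun n => by exact_mod_cast (hB n)
  obtain ⟨N, hN⟩ := eventually_atTop.1 ((hratio ((lam - μ) / 2) (by linarith)).and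
    (hlog.eventually_gt_atTop (2 * Real.log 2 / (lam - μ))))
  refine Set.infinite_of_injective_forall_mem (f := fun n => (P (n + N), B (n + N))) ?_ ?_
  · intro i j hij
    have := hBmono.injective (Prod.ext_iff.1 hij).2
    omega
  · intro n
    obtain ⟨h1, h2⟩ := hN (n + N) (by omega)
    have h3 : (0 : ℝ) < α - P (n + N) / B (n + N) :=
      lt_of_lt_of_le (one_div_pos.2 (hBR _)) (hlow _)
    refine ⟨hB _, abs_pos.2 h3.ne', ?_⟩
    simp only
    rw [abs_of_pos h3]
    refine lt_of_le_of_lt (hupp _) ?_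
    rw [div_lt_div_iff₀ (hBR _) (Real.rpow_pos_of_pos (hBR _) _), one_mul]
    rw [← Real.log_lt_log_iff (mul_pos two_pos (Real.rpow_pos_of_pos (hBR _) _)) (hBR _),
      Real.log_mul two_ne_zero (Real.rpow_pos_of_pos (hBR _) _).ne', Real.log_rpow (hBR _)]
    rw [div_lt_iff₀ (by linarith)] at h2
    have := (abs_le.1 h1).1
    linarith

/-- A rational number different from an approximation `P' / B` of `α` is far from `α`. -/
lemma one_div_le_abs_sub_of_ne {α : ℝ} {P Q P' B b : ℤ} (hQ : 1 ≤ Q) (hB : 1 ≤ B)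
    (hb : 4 * Q ≤ b) (hα0 : 0 ≤ α - P' / B) (hα : α - P' / B ≤ 2 / ((B * b : ℤ) : ℝ))
    (hne : P * B ≠ P' * Q) : 1 / (2 * Q * B : ℝ) ≤ |α - P / Q| := by
  have hQ' : (0 : ℝ) < Q := by exact_mod_cast hQ
  have hB' : (0 : ℝ) < B := by exact_mod_cast hB
  have hb' : (4 : ℝ) * Q ≤ b := by exact_mod_cast hb
  have h1 : 1 / (Q * B : ℝ) ≤ |(P : ℝ) / Q - P' / B| := by
    rw [div_sub_div _ _ hQ'.ne' hB'.ne', abs_div, abs_of_pos (mul_pos hQ' hB')]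
    gcongr
    have : 1 ≤ |P * B - Q * P'| := Int.one_le_abs (sub_ne_zero.2 (by rwa [mul_comm Q]))
    exact_mod_cast this
  have h2 : 2 / ((B * b : ℤ) : ℝ) ≤ 1 / (2 * Q * B) := by
    push_cast
    rw [div_le_div_iff₀ (by nlinarith) (by positivity)]
    nlinarith
  have h3 : |(P : ℝ) / Q - P' / B| ≤ |α - P / Q| + |α - P' / B| := by
    rw [show (P : ℝ) / Q - P' / B = (α - P' / B) - (α - P / Q) by ring, add_comm]
    exact abs_sub _ _
  rw [abs_of_nonneg hα0] at h3
  have h4 : 1 / (Q * B : ℝ) = 1 / (2 * Q * B) + 1 / (2 * Q * B) := by field_simp; norm_num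
  linarith

/-- An approximation set is finite as soon as its denominators are bounded. -/
lemma finite_approxSet_of_bounded {α μ : ℝ} (hμ : 0 ≤ μ) {Q₀ : ℤ}
    (h : ∀ PQ ∈ approxSet α μ, PQ.2 ≤ Q₀) : (approxSet α μ).Finite := by
  refine ((Set.finite_Icc (-(⌈|α| + 1⌉ * Q₀)) (⌈|α| + 1⌉ * Q₀)).prod
    (Set.finite_Icc 1 Q₀)).subset ?_
  rintro ⟨P, Q⟩ hPQ
  have hQ0 := h _ hPQ
  obtain ⟨hQ, -, hlt⟩ := hPQ
  simp only at hQ hlt hQ0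
  refine ⟨?_, hQ, hQ0⟩
  have hQ' : (1 : ℝ) ≤ Q := by exact_mod_cast hQ
  have h1 : 1 / (Q : ℝ) ^ μ ≤ 1 := by
    rw [div_le_one (by positivity)]
    exact Real.one_le_rpow hQ' hμ
  have h2 : |(P : ℝ) / Q| ≤ |α| + 1 := by
    have := abs_sub_abs_le_abs_sub ((P : ℝ) / Q) α
    rw [abs_sub_comm] at this
    linarith
  have hQp : (0 : ℝ) < Q := by linarith
  rw [abs_div, abs_of_pos hQp, div_le_iff₀ hQp] at h2
  have h3 : |(P : ℝ)| ≤ ((⌈|α| + 1⌉ * Q₀ : ℤ) : ℝ) := by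
    push_cast
    calc |(P : ℝ)| ≤ (|α| + 1) * Q := h2
      _ ≤ ⌈|α| + 1⌉ * (Q₀ : ℝ) := by
        have : (Q : ℝ) ≤ Q₀ := by exact_mod_cast hQ0
        gcongr
        exact Int.le_ceil _
  exact abs_le.1 (by exact_mod_cast h3)

lemma natCast_le_of_strictMono {b : ℕ → ℤ} (hb : StrictMono b) (h0 : 0 ≤ b 0) (n : ℕ) :
    (n : ℤ) ≤ b n := by
  induction n with
  | zero => exact_mod_cast h0
  | succ n ih =>
    have := hb (Nat.lt_add_one n)
    push_cast
    omega

/-- Rational approximations `P n / B n` in lowest terms, together with an error of order exactly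
`1 / B (n+1)`, where `B (n+1)` grows like `B n ^ lam`, bound the exponent of approximation by
`lam`. -/
lemma finite_approxSet {α lam : ℝ} {P B b : ℕ → ℤ} (hB : ∀ n, 1 ≤ B n)
    (hlam : 2 ≤ lam) (hlam2 : lam ≤ (lam - 1) ^ 2) (hBb : ∀ n, B (n + 1) = B n * b n)
    (hb : StrictMono b) (hcop : ∀ n, IsCoprime (P n) (B n))
    (hlow : ∀ n, 1 / (B (n + 1) : ℝ) ≤ α - P n / B n)
    (hupp : ∀ n, α - P n / B n ≤ 2 / (B (n + 1) : ℝ))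
    (hlog : Tendsto (fun n => Real.log (B n)) atTop atTop)
    (hratio : ∀ ε : ℝ, 0 < ε →
      ∀ᶠ n in atTop, |Real.log (B (n + 1)) - lam * Real.log (B n)| ≤ ε * Real.log (B n))
    {μ : ℝ} (hμ : lam < μ) : (approxSet α μ).Finite := by
  have hBR : ∀ n, (0 : ℝ) < B n := fun n => by exact_mod_cast (hB n)
  have hb1 : ∀ n, 1 ≤ b n := by
    intro n
    have h1 := hB n
    have h2 := hB (n + 1)
    rw [hBb] at h2
    by_contra h
    nlinarith
  have hbR : ∀ n, (0 : ℝ) < b n := fun n => by exact_mod_cast (hb1 n)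
  have hδ : 0 < μ - lam := by linarith
  set ε := (μ - lam) * (lam - 1) / (2 * μ) with hε
  have hε0 : 0 < ε := div_pos (mul_pos hδ (by linarith)) (by linarith)
  have hεμ : ε * μ = (μ - lam) * (lam - 1) / 2 := by
    have : μ ≠ 0 := by linarith
    rw [hε]; field_simp
  have hεδ : ε < μ - lam := by
    rw [hε, div_lt_iff₀ (by linarith)]; nlinarith
  set C := Real.log 2 + (μ - 1) * Real.log 4 with hC
  obtain ⟨N, hN⟩ := eventually_atTop.1 ((hratio ε hε0).and
    ((hlog.eventually_gt_atTop (C / (ε * μ))).and (hlog.eventually_gt_atTop 0)))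
  refine finite_approxSet_of_bounded (by linarith) (Q₀ := b N) ?_
  rintro ⟨R, Q⟩ ⟨hQ, -, hlt⟩
  simp only at hQ hlt ⊢
  by_contra! hQN
  have hQ' : (0 : ℝ) < Q := by exact_mod_cast hQ
  have hex : ∃ n, 4 * Q ≤ b n :=
    ⟨(4 * Q).toNat, (Int.self_le_toNat _).trans
      (natCast_le_of_strictMono hb (by have := hb1 0; omega) _)⟩
  obtain ⟨n, hnN, hn1, hn2⟩ : ∃ n, N ≤ n ∧ b n < 4 * Q ∧ 4 * Q ≤ b (n + 1) := by
    have hspec := Nat.find_spec hex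
    have hgt : N < Nat.find hex := by
      by_contra! hle
      have := hb.monotone hle
      omega
    obtain ⟨n, hn⟩ : ∃ n, Nat.find hex = n + 1 := ⟨Nat.find hex - 1, by omega⟩
    refine ⟨n, by omega, not_le.1 (Nat.find_min hex (by omega)), by rwa [← hn]⟩
  have hpow := Real.rpow_pos_of_pos hQ' μ
  have hαlow := hlow (n + 1)
  have hα0 : 0 < α - P (n + 1) / B (n + 1) := lt_of_lt_of_le (one_div_pos.2 (hBR _)) hαlow
  by_cases hne : R * B (n + 1) = P (n + 1) * Q
  · have hdvd : B (n + 1) ∣ Q :=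
      (hcop (n + 1)).symm.dvd_of_dvd_mul_left ⟨R, by rw [← hne, mul_comm]⟩
    have hle : (B (n + 1) : ℝ) ≤ Q := by exact_mod_cast Int.le_of_dvd (by omega) hdvd
    have heq : (R : ℝ) / Q = P (n + 1) / B (n + 1) := by
      rw [div_eq_div_iff hQ'.ne' (hBR _).ne']; exact_mod_cast hne
    rw [heq, abs_of_pos hα0] at hlt
    have h1 : 1 / (B (n + 1 + 1) : ℝ) < 1 / (B (n + 1) : ℝ) ^ μ := by
      refine (hαlow.trans_lt hlt).trans_le (one_div_le_one_div_of_le ?_ ?_)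
      · exact Real.rpow_pos_of_pos (hBR _) _
      · exact Real.rpow_le_rpow (hBR _).le hle (by linarith)
    rw [one_div_lt_one_div (hBR _) (Real.rpow_pos_of_pos (hBR _) _)] at h1
    have h2 := Real.log_lt_log (Real.rpow_pos_of_pos (hBR _) _) h1
    rw [Real.log_rpow (hBR _)] at h2
    obtain ⟨h3, -, h4⟩ := hN (n + 1) (by omega)
    have h5 := (abs_le.1 h3).2
    nlinarith
  · have hu := hupp (n + 1)
    rw [hBb (n + 1)] at hu
    have h1 := (one_div_le_abs_sub_of_ne hQ (hB _) hn2 hα0.le hu hne).trans_lt hlt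
    have h2Q : (0 : ℝ) < 2 * Q * B (n + 1) := by have := hBR (n + 1); positivity
    rw [one_div_lt_one_div h2Q hpow] at h1
    have h2 := Real.log_lt_log hpow h1
    rw [Real.log_rpow hQ', Real.log_mul (by positivity) (hBR _).ne',
      Real.log_mul two_ne_zero hQ'.ne'] at h2
    have h3 : Real.log (B (n + 1)) = Real.log (B n) + Real.log (b n) := by
      rw [hBb, Int.cast_mul, Real.log_mul (hBR _).ne' (hbR _).ne']
    have h4 : Real.log (b n) < Real.log 4 + Real.log Q := by
      rw [← Real.log_mul (by norm_num) hQ'.ne']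
      exact Real.log_lt_log (hbR _) (by exact_mod_cast hn1)
    obtain ⟨h5, h6, h7⟩ := hN n hnN
    rw [div_lt_iff₀ (by nlinarith)] at h6
    set t := Real.log (B n)
    set s := Real.log (B (n + 1))
    obtain ⟨h8, h9⟩ := abs_le.1 h5
    have h10 : (μ - 1) * (s - t - Real.log 4) < Real.log 2 + s := by
      have : (μ - 1) * (s - t - Real.log 4) ≤ (μ - 1) * Real.log Q :=
        mul_le_mul_of_nonneg_left (by linarith) (by linarith)
      linarith
    have h11 : (μ - 2) * ((lam - ε) * t) ≤ (μ - 2) * s :=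
      mul_le_mul_of_nonneg_left (by linarith) (by linarith)
    have h12 : t * (ε * μ) ≤ ((μ - 2) * (lam - ε) - (μ - 1)) * t := by
      rw [mul_comm t]
      refine mul_le_mul_of_nonneg_right ?_ h7.le
      nlinarith
    nlinarith

/-- The two sequences of a modified Engel recurrence are positive. -/
lemma engel_pos {u x y : ℕ → ℤ} (hu : ∀ n, 1 ≤ n → 1 ≤ u n) (hx1 : 1 ≤ x 1) (hy0 : 1 ≤ y 0)
    (hrec : ∀ j, 1 ≤ j → y j = y (j - 1) * (1 + u j * x j) ∧ x (j + 1) = x j * y j) (n : ℕ) :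
    1 ≤ x (n + 1) ∧ 1 ≤ y n := by
  induction n with
  | zero => exact ⟨hx1, hy0⟩
  | succ n ih =>
    obtain ⟨h1, h2⟩ := hrec (n + 1) (by omega)
    have h3 := hu (n + 1) (by omega)
    simp only [Nat.add_sub_cancel] at h1
    have h4 : 1 ≤ y (n + 1) := by nlinarith [mul_le_mul h3 ih.1 zero_le_one (by omega)]
    exact ⟨by nlinarith, h4⟩

/-- The second sequence of a modified Engel recurrence at least doubles at each step. -/
lemma engel_two_mul_le {u x y : ℕ → ℤ} (hu : ∀ n, 1 ≤ n → 1 ≤ u n) (hx1 : 1 ≤ x 1)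
    (hy0 : 1 ≤ y 0)
    (hrec : ∀ j, 1 ≤ j → y j = y (j - 1) * (1 + u j * x j) ∧ x (j + 1) = x j * y j) (n : ℕ) :
    2 * y n ≤ y (n + 1) ∧ 2 * x (n + 1) ≤ x (n + 2) := by
  obtain ⟨hx, hy⟩ := engel_pos hu hx1 hy0 hrec n
  obtain ⟨h1, h2⟩ := hrec (n + 1) (by omega)
  have h3 := hu (n + 1) (by omega)
  simp only [Nat.add_sub_cancel] at h1
  have h4 : 2 * y n ≤ y (n + 1) := by nlinarith [mul_le_mul h3 hx zero_le_one (by omega)]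
  refine ⟨h4, ?_⟩
  rw [h2]
  nlinarith

/-- Numerators of the partial sums of a modified Engel series, over the denominators `x`. -/
def engelNum (p : ℤ) (y : ℕ → ℤ) : ℕ → ℤ
  | 0 => p
  | n + 1 => engelNum p y n * y (n + 1) + 1

lemma engelNum_div {p : ℤ} {x y : ℕ → ℤ} (hx : ∀ n, 1 ≤ x (n + 1))
    (hrec : ∀ j, 1 ≤ j → x (j + 1) = x j * y j) (n : ℕ) :
    (engelNum p y n : ℝ) / x (n + 1) =
      (p : ℝ) / x 1 + ∑ j ∈ Finset.range n, (1 : ℝ) / x (j + 2) := by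
  induction n with
  | zero => simp [engelNum]
  | succ n ih =>
    rw [Finset.sum_range_succ, ← add_assoc, ← ih]
    have h1 : (x (n + 1) : ℝ) ≠ 0 := by have := hx n; norm_cast; omega
    have h2 : (x (n + 1 + 1) : ℝ) ≠ 0 := by have := hx (n + 1); norm_cast; omega
    have h3 : (x (n + 1 + 1) : ℝ) = x (n + 1) * y (n + 1) := by
      exact_mod_cast hrec (n + 1) (by omega)
    have h4 : (y (n + 1) : ℝ) ≠ 0 := by
      rintro h; rw [h, mul_zero] at h3; exact h2 h3
    rw [show n + 2 = n + 1 + 1 by ring, h3]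
    simp only [engelNum]
    push_cast
    field_simp

lemma dvd_engelNum_mul_add_one {p : ℤ} {u x y : ℕ → ℤ} (h0 : x 1 ∣ p * (y 0 - 1) + 1)
    (hrec : ∀ j, 1 ≤ j → y j = y (j - 1) * (1 + u j * x j) ∧ x (j + 1) = x j * y j) (n : ℕ) :
    x (n + 1) ∣ engelNum p y n * (y n - 1) + 1 := by
  induction n with
  | zero => simpa [engelNum] using h0
  | succ n ih =>
    obtain ⟨h1, h2⟩ := hrec (n + 1) (by omega)
    simp only [Nat.add_sub_cancel] at h1
    obtain ⟨w, hw⟩ := ih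
    refine ⟨w + engelNum p y n * y n * u (n + 1), ?_⟩
    simp only [engelNum]
    rw [h2]
    have h3 : engelNum p y n * (y (n + 1) - 1) + 1
        = x (n + 1) * (w + engelNum p y n * y n * u (n + 1)) := by
      rw [h1]; linear_combination hw
    linear_combination y (n + 1) * h3

/-- The determinant identity for continuants. -/
lemma continuant_det {a P Q : ℕ → ℤ} (hP0 : P 0 = 0) (hP1 : P 1 = 1) (hQ0 : Q 0 = 1)
    (hQ1 : Q 1 = 0) (hP : ∀ n, P (n + 2) = a n * P (n + 1) + P n)
    (hQ : ∀ n, Q (n + 2) = a n * Q (n + 1) + Q n) (n : ℕ) :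
    P (n + 1) * Q n - P n * Q (n + 1) = (-1) ^ n := by
  induction n with
  | zero => simp [hP0, hP1, hQ0, hQ1]
  | succ n ih =>
    rw [hP, hQ, pow_succ]
    linear_combination -ih

lemma continuant_nonneg {a Q : ℕ → ℤ} {M : ℕ} (ha : ∀ j, 1 ≤ j → j ≤ M → 1 ≤ a j)
    (hQ0 : Q 0 = 1) (hQ1 : Q 1 = 0) (hQ : ∀ n, Q (n + 2) = a n * Q (n + 1) + Q n) {n : ℕ}
    (hn : n ≤ M + 1) : 0 ≤ Q n ∧ 0 ≤ Q (n + 1) := by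
  induction n with
  | zero => simp [hQ0, hQ1]
  | succ n ih =>
    obtain ⟨h1, h2⟩ := ih (by omega)
    refine ⟨h2, ?_⟩
    rw [hQ]
    rcases Nat.eq_zero_or_pos n with rfl | h
    · simp [hQ0, hQ1]
    · have := ha n h (by omega)
      positivity

/-- An exponential bound may be assumed to have base at least `1`. -/
lemma exists_one_le_base {f : ℕ → ℝ} {lam : ℝ} (hlam : 1 < lam)
    (h : ∃ ν : ℝ, ν < lam ∧ ∃ K : ℝ, ∃ N : ℕ, ∀ n, N ≤ n → |f n| ≤ K * ν ^ n) :
    ∃ ν : ℝ, 1 ≤ ν ∧ ν < lam ∧ ∃ K : ℝ, 0 ≤ K ∧ ∃ N : ℕ, ∀ n, N ≤ n → |f n| ≤ K * ν ^ n := by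
  obtain ⟨ν, hν, K, N, hb⟩ := h
  refine ⟨max ν 1, le_max_right _ _, max_lt hν hlam, |K|, abs_nonneg _, N, fun n hn => ?_⟩
  rcases le_or_gt 0 ν with h0 | h0
  · calc |f n| ≤ K * ν ^ n := hb n hn
      _ ≤ |K| * max ν 1 ^ n := by
        gcongr
        · exact le_abs_self K
        · exact le_max_left _ _
  · have h1 := (abs_nonneg _).trans (hb n hn)
    have h2 := (abs_nonneg _).trans (hb (n + 1) (by omega))
    have h3 := hb n hn
    have h4 : K * ν ^ n ≤ 0 := by
      rw [pow_succ, ← mul_assoc] at h2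
      nlinarith
    have : 0 ≤ |K| * max ν 1 ^ n := by positivity
    linarith

/-- The leading term of `∑ v_j x ^ (d-1-j)` dominates when the `v_j` are `O(v_0)`. -/
lemma eventually_abs_sum_sub_le {d : ℕ} (hd : 1 ≤ d) {v : ℕ → ℕ → ℤ} {x : ℕ → ℤ}
    (hv0 : ∀ n, 1 ≤ n → 1 ≤ v 0 n) (hx : Tendsto (fun n => (x n : ℝ)) atTop atTop)
    (hvj : ∀ j, 1 ≤ j → j ≤ d - 1 →
      ∃ K : ℝ, ∃ N : ℕ, ∀ n, N ≤ n → |((v j n : ℤ) : ℝ)| ≤ K * ((v 0 n : ℤ) : ℝ)) :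
    ∀ᶠ n in atTop, |((∑ j ∈ Finset.range d, v j n * x n ^ (d - 1 - j) : ℤ) : ℝ)
      - v 0 n * (x n : ℝ) ^ (d - 1)| ≤ v 0 n * (x n : ℝ) ^ (d - 1) / 2 := by
  have hd0 : (0 : ℝ) < d := by exact_mod_cast hd
  have key : ∀ᶠ n in atTop, ∀ j ∈ Finset.Ico 1 d,
      |(v j n : ℝ) * (x n : ℝ) ^ (d - 1 - j)| ≤ v 0 n * (x n : ℝ) ^ (d - 1) / (2 * d) := by
    rw [Filter.eventually_all_finset]
    intro j hj
    rw [Finset.mem_Ico] at hj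
    obtain ⟨K, N, hK⟩ := hvj j hj.1 (by omega)
    filter_upwards [eventually_ge_atTop N, hx.eventually_ge_atTop (2 * d * K),
      hx.eventually_ge_atTop 1, eventually_ge_atTop 1] with n hn hxn hx1 hn1
    have hv : (1 : ℝ) ≤ v 0 n := by exact_mod_cast hv0 n hn1
    have hx0 : (0 : ℝ) < x n := by linarith
    rw [abs_mul, abs_of_nonneg (pow_nonneg hx0.le _), le_div_iff₀ (by positivity)]
    have h1 : (x n : ℝ) ^ (d - 1 - j) ≤ (x n : ℝ) ^ (d - 2) :=
      pow_le_pow_right₀ hx1 (by omega)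
    have h2 : (x n : ℝ) ^ (d - 1) = (x n : ℝ) ^ (d - 2) * x n := by
      rw [← pow_succ]; congr 1; omega
    have hK0 : 0 ≤ K * (v 0 n : ℝ) := (abs_nonneg _).trans (hK n hn)
    calc |(v j n : ℝ)| * (x n : ℝ) ^ (d - 1 - j) * (2 * d)
        ≤ K * v 0 n * (x n : ℝ) ^ (d - 2) * (2 * d) := by
          gcongr
          exact hK n hn
      _ = v 0 n * (x n : ℝ) ^ (d - 2) * (2 * d * K) := by ring
      _ ≤ v 0 n * (x n : ℝ) ^ (d - 2) * x n := by gcongr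
      _ = v 0 n * (x n : ℝ) ^ (d - 1) := by rw [h2]; ring
  filter_upwards [key, hx.eventually_ge_atTop 1, eventually_ge_atTop 1] with n hn hx1 hn1
  have hv : (1 : ℝ) ≤ v 0 n := by exact_mod_cast hv0 n hn1
  have hT : 0 ≤ v 0 n * (x n : ℝ) ^ (d - 1) := by positivity
  push_cast
  rw [Finset.range_eq_Ico, Finset.sum_eq_sum_Ico_succ_bot (by omega)]
  simp only [Nat.sub_zero, zero_add, add_sub_cancel_left]
  refine (Finset.abs_sum_le_sum_abs _ _).trans ((Finset.sum_le_card_nsmul _ _ _ hn).trans ?_)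
  rw [Nat.card_Ico, nsmul_eq_mul]
  calc ((d - 1 : ℕ) : ℝ) * (v 0 n * (x n : ℝ) ^ (d - 1) / (2 * d))
      ≤ d * (v 0 n * (x n : ℝ) ^ (d - 1) / (2 * d)) := by
        gcongr
        exact Nat.sub_le _ _
    _ = v 0 n * (x n : ℝ) ^ (d - 1) / 2 := by field_simp

/-- The logarithmic growth rate of the denominators of a modified Engel series. -/
lemma engel_log_ratio {u x y : ℕ → ℤ} (hu : ∀ n, 1 ≤ n → 1 ≤ u n) (hx1 : 1 ≤ x 1)
    (hy0 : 1 ≤ y 0)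
    (hrec : ∀ j, 1 ≤ j → y j = y (j - 1) * (1 + u j * x j) ∧ x (j + 1) = x j * y j)
    {d : ℕ} (hd : 1 ≤ d) {v : ℕ → ℤ} (hv : ∀ n, 1 ≤ n → 1 ≤ v n)
    (hxlim : Tendsto (fun n => (x n : ℝ)) atTop atTop)
    (hux : ∀ᶠ n in atTop, |(u n : ℝ) - v n * (x n : ℝ) ^ (d - 1)|
      ≤ v n * (x n : ℝ) ^ (d - 1) / 2)
    {lam : ℝ} (hlam : 2 ≤ lam) (hchar : lam ^ 2 = (d + 2) * lam - 1)
    (hlog : ∃ ν : ℝ, ν < lam ∧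
      ∃ K : ℝ, ∃ N : ℕ, ∀ n, N ≤ n → |Real.log (v n)| ≤ K * ν ^ n)
    {ε : ℝ} (hε : 0 < ε) :
    ∀ᶠ n in atTop, |Real.log (x (n + 1)) - lam * Real.log (x n)| ≤ ε * Real.log (x n) := by
  obtain ⟨ν, hν1, hν, K, hK, N, hN⟩ := exists_one_le_base (by linarith) hlog
  obtain ⟨N', hN'⟩ := eventually_atTop.1 hux
  have hpos := engel_pos hu hx1 hy0 hrec
  have hx : ∀ n, 1 ≤ n → (1 : ℝ) ≤ x n := by
    intro n hn
    obtain ⟨i, rfl⟩ : ∃ i, n = i + 1 := ⟨n - 1, by omega⟩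
    exact_mod_cast (hpos i).1
  have hbound : ∀ n, max 1 (max N N') ≤ n →
      -Real.log 2 ≤ Real.log (1 + u (n + 1) * x (n + 1)) - d * Real.log (x (n + 1)) ∧
      Real.log (1 + u (n + 1) * x (n + 1)) - d * Real.log (x (n + 1))
        ≤ Real.log 3 + K * ν ^ (n + 1) := by
    intro n hn
    simp only [max_le_iff] at hn
    obtain ⟨hn1, hn2, hn3⟩ := hn
    have h1 := abs_le.1 (hN' (n + 1) (by omega))
    have h2 : (1 : ℝ) ≤ v (n + 1) := by exact_mod_cast hv (n + 1) (by omega)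
    have h3 := hx (n + 1) (by omega)
    have h4 := (abs_le.1 (hN (n + 1) (by omega))).2
    have h5 := Real.log_nonneg h2
    set X := (x (n + 1) : ℝ)
    set V := (v (n + 1) : ℝ)
    set U := (u (n + 1) : ℝ)
    have hX0 : 0 < X := by linarith
    have hXd : X ^ d = X ^ (d - 1) * X := by rw [← pow_succ]; congr 1; omega
    have hXd1 : 1 ≤ X ^ d := one_le_pow₀ h3
    have h6 : V * X ^ d / 2 ≤ 1 + U * X := by
      rw [hXd]; nlinarith
    have h7 : 1 + U * X ≤ 3 * (V * X ^ d) := by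
      have : 1 ≤ V * X ^ d := by nlinarith
      have : U * X ≤ (3 / 2 * (V * X ^ (d - 1))) * X :=
        mul_le_mul_of_nonneg_right (by linarith) hX0.le
      nlinarith
    have hV0 : 0 < V := by linarith
    have hVX : 0 < V * X ^ d := by positivity
    have h8 := Real.log_le_log (by positivity) h6
    have h9 := Real.log_le_log (by linarith) h7
    rw [Real.log_div (by positivity) (by norm_num), Real.log_mul hV0.ne' (by positivity),
      Real.log_pow] at h8
    rw [Real.log_mul (by norm_num) (by positivity), Real.log_mul hV0.ne' (by positivity),
      Real.log_pow] at h9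
    constructor <;> linarith
  have hlog2 : 0 < Real.log 2 := Real.log_pos (by norm_num)
  have hlog23 : Real.log 2 ≤ Real.log 3 := Real.log_le_log (by norm_num) (by norm_num)
  refine eventually_abs_sub_mul_le_of_recurrence (X := fun n => Real.log (x n))
    (e := fun n => Real.log (1 + u (n + 1) * x (n + 1)) - d * Real.log (x (n + 1)))
    (N := max 1 (max N N')) (C := Real.log 2) (K := Real.log 3 + K * ν)
    hlam hchar hν1 hν hlog2.le ?_ ?_ (fun n hn => (hbound n hn).1) ?_ ?_
    (Real.tendsto_log_atTop.comp hxlim) hε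
  · intro n hn
    have hn1 : 1 ≤ n := (le_max_left _ _).trans hn
    obtain ⟨h1, h2⟩ := hrec (n + 1) (by omega)
    have h3 := (hrec n hn1).2
    have hxn := hx n hn1
    have hxn1 := hx (n + 1) (by omega)
    have hyn : (1 : ℝ) ≤ y n := by exact_mod_cast (hpos n).2
    have hun : (1 : ℝ) ≤ u (n + 1) := by exact_mod_cast hu (n + 1) (by omega)
    simp only [Nat.add_sub_cancel] at h1
    have h4 : Real.log (x (n + 1)) = Real.log (x n) + Real.log (y n) := by
      rw [h3, Int.cast_mul, Real.log_mul (by positivity) (by positivity)]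
    have h5 : Real.log (x (n + 2)) = Real.log (x (n + 1)) + (Real.log (y n)
        + Real.log (1 + u (n + 1) * x (n + 1))) := by
      rw [h2, h1]
      push_cast
      rw [Real.log_mul (by positivity) (by positivity),
        Real.log_mul (by positivity) (by positivity)]
    rw [h5]
    linear_combination -h4
  · intro n hn
    obtain ⟨h1, h2⟩ := hbound n hn
    have h3 : 1 ≤ ν ^ n := one_le_pow₀ hν1
    have h4 : Real.log 3 ≤ Real.log 3 * ν ^ n := by nlinarith
    have h5 : 0 ≤ K * ν * ν ^ n := by positivity
    rw [pow_succ] at h2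
    rw [abs_le]
    constructor <;> linarith
  · intro n hn
    have hn1 : 1 ≤ n := (le_max_left _ _).trans hn
    have hxn := hx n hn1
    refine Real.log_le_log (by linarith) ?_
    obtain ⟨i, rfl⟩ : ∃ i, n = i + 1 := ⟨n - 1, by omega⟩
    have h1 := (engel_two_mul_le hu hx1 hy0 hrec i).2
    have h2 := (hpos i).1
    exact_mod_cast (by omega : x (i + 1) ≤ x (i + 2))
  · exact fun n hn => Real.log_nonneg (hx n ((le_max_left _ _).trans hn))

/-- **Theorem 3.3 (Engel case).**  If `u n = ∑_{j=0}^{d-1} v_n^{(j)} x_n^{d-1-j}` with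
`v_n^{(0)} ≥ 1`, `log v_n^{(0)} = O(ν^n)` for some `ν < λ = (d + 2 + √(d(d+4)))/2`, and
`v_n^{(j)} = O(v_n^{(0)})` for `1 ≤ j ≤ d-1`, then the modified Engel series
`α = p/q + ∑_{j≥2} 1/x_j` has irrationality exponent exactly `λ`: the approximation set is
infinite for every `μ < λ` and finite for every `μ > λ`. -/
theorem engel_modified_irrationality_exponent
    (k : ℕ) (a : ℕ → ℤ) (ha : ∀ j, 1 ≤ j → j ≤ 2 * k → 1 ≤ a j)
    (pc qc : ℕ → ℤ)
    (hpc0 : pc 0 = 0) (hpc1 : pc 1 = 1) (hqc0 : qc 0 = 1) (hqc1 : qc 1 = 0)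
    (hpc : ∀ n, pc (n + 2) = a n * pc (n + 1) + pc n)
    (hqc : ∀ n, qc (n + 2) = a n * qc (n + 1) + qc n)
    (p q : ℤ) (hq : 1 ≤ q) (hcop : Int.gcd p q = 1)
    (hp : p = pc (2 * k + 2)) (hqv : q = qc (2 * k + 2))
    (m : ℤ) (hm : 0 ≤ m)
    (u x y : ℕ → ℤ) (hu : ∀ n, 1 ≤ n → 1 ≤ u n)
    (hx1 : x 1 = q) (hy0 : y 0 = m * q + qc (2 * k + 1) + 1)
    (hrec : ∀ j, 1 ≤ j → y j = y (j - 1) * (1 + u j * x j) ∧ x (j + 1) = x j * y j)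
    (d : ℕ) (hd : 1 ≤ d) (v : ℕ → ℕ → ℤ)
    (hudef : ∀ n, 1 ≤ n → u n = ∑ j ∈ Finset.range d, v j n * x n ^ (d - 1 - j))
    (hv0 : ∀ n, 1 ≤ n → 1 ≤ v 0 n)
    (hlog : ∃ ν : ℝ, ν < ((d : ℝ) + 2 + Real.sqrt (d * (d + 4))) / 2 ∧
      ∃ K : ℝ, ∃ N : ℕ, ∀ n, N ≤ n → |Real.log ((v 0 n : ℤ) : ℝ)| ≤ K * ν ^ n)
    (hvj : ∀ j, 1 ≤ j → j ≤ d - 1 →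
      ∃ K : ℝ, ∃ N : ℕ, ∀ n, N ≤ n → |((v j n : ℤ) : ℝ)| ≤ K * ((v 0 n : ℤ) : ℝ))
    (α : ℝ) (hα : α = (p : ℝ) / (q : ℝ) + ∑' j : ℕ, (1 : ℝ) / (x (j + 2) : ℝ)) :
    (∀ μ : ℝ, μ < ((d : ℝ) + 2 + Real.sqrt (d * (d + 4))) / 2 → (approxSet α μ).Infinite) ∧
    (∀ μ : ℝ, ((d : ℝ) + 2 + Real.sqrt (d * (d + 4))) / 2 < μ → (approxSet α μ).Finite) := by
  have hdet := continuant_det hpc0 hpc1 hqc0 hqc1 hpc hqc (2 * k + 1)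
  have hqnn := (continuant_nonneg ha hqc0 hqc1 hqc le_rfl).1
  have hy0' : 1 ≤ y 0 := by nlinarith
  have hx1' : 1 ≤ x 1 := by rw [hx1]; exact hq
  have hdvd0 : x 1 ∣ p * (y 0 - 1) + 1 := by
    refine ⟨p * m + pc (2 * k + 1), ?_⟩
    rw [Odd.neg_one_pow ⟨k, rfl⟩] at hdet
    rw [hx1, hy0]
    rw [← hp, ← hqv] at hdet
    linear_combination hdet
  have hpos := engel_pos hu hx1' hy0' hrec
  have htwo := engel_two_mul_le hu hx1' hy0' hrec
  have hcopr : ∀ n, IsCoprime (engelNum p y n) (x (n + 1)) := by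
    intro n
    obtain ⟨w, hw⟩ := dvd_engelNum_mul_add_one hdvd0 hrec n
    exact ⟨-(y n - 1), w, by linear_combination -hw⟩
  have hxmono : StrictMono fun n => x (n + 1) :=
    strictMono_nat_of_lt_succ fun n => by
      have := (htwo n).2
      have := (hpos n).1
      show x (n + 1) < x (n + 2)
      omega
  have hymono : StrictMono fun n => y (n + 1) :=
    strictMono_nat_of_lt_succ fun n => by
      have := (htwo (n + 1)).1
      have := (hpos (n + 1)).2
      show y (n + 1) < y (n + 1 + 1)
      omega
  have hxlim1 : Tendsto (fun n => (x (n + 1) : ℝ)) atTop atTop :=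
    tendsto_atTop_mono (fun n => by
      exact_mod_cast natCast_le_of_strictMono hxmono (zero_le_one.trans hx1') n)
      tendsto_natCast_atTop_atTop
  have hxlim : Tendsto (fun n => (x n : ℝ)) atTop atTop := (tendsto_add_atTop_iff_nat 1).1 hxlim1
  have hloglim : Tendsto (fun n => Real.log (x (n + 1))) atTop atTop :=
    Real.tendsto_log_atTop.comp hxlim1
  set lam : ℝ := ((d : ℝ) + 2 + Real.sqrt (d * (d + 4))) / 2 with hlam
  have hd1 : (1 : ℝ) ≤ d := by exact_mod_cast hd
  have hsq := Real.sq_sqrt (by positivity : (0 : ℝ) ≤ d * (d + 4))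
  have hs1 : 1 ≤ Real.sqrt (d * (d + 4)) := Real.one_le_sqrt.2 (by nlinarith)
  have hlam2 : 2 ≤ lam := by linarith
  have hchar : lam ^ 2 = (d + 2) * lam - 1 := by
    rw [hlam]; linear_combination hsq / 4
  have hux : ∀ᶠ n in atTop, |(u n : ℝ) - v 0 n * (x n : ℝ) ^ (d - 1)|
      ≤ v 0 n * (x n : ℝ) ^ (d - 1) / 2 := by
    filter_upwards [eventually_abs_sum_sub_le hd hv0 hxlim hvj, eventually_ge_atTop 1]
      with n hn hn1
    rwa [← hudef n hn1] at hn
  have hratio : ∀ ε : ℝ, 0 < ε → ∀ᶠ n in atTop,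
      |Real.log (x (n + 1 + 1)) - lam * Real.log (x (n + 1))| ≤ ε * Real.log (x (n + 1)) :=
    fun ε hε => (tendsto_add_atTop_nat 1).eventually
      (engel_log_ratio hu hx1' hy0' hrec hd hv0 hxlim hux hlam2 hchar hlog hε)
  have hxR : ∀ n, (0 : ℝ) < x (n + 1) := fun n => by exact_mod_cast (hpos n).1
  obtain ⟨hsum, hbounds⟩ := tsum_inv_tail_bounds (f := fun j => (x (j + 2) : ℝ))
    (fun n => hxR (n + 1)) (fun n => by exact_mod_cast (htwo (n + 1)).2)
  have hdiff : ∀ n, α - engelNum p y n / x (n + 1) = ∑' j, 1 / (x (j + n + 2) : ℝ) := by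
    intro n
    rw [engelNum_div (fun n => (hpos n).1) (fun j hj => (hrec j hj).2) n, hα, hx1,
      ← hsum.sum_add_tsum_nat_add n]
    ring
  have hlow : ∀ n, 1 / (x (n + 1 + 1) : ℝ) ≤ α - engelNum p y n / x (n + 1) := fun n => by
    rw [hdiff]; exact (hbounds n).1
  have hupp : ∀ n, α - engelNum p y n / x (n + 1) ≤ 2 / (x (n + 1 + 1) : ℝ) := fun n => by
    rw [hdiff]; exact (hbounds n).2
  refine ⟨fun μ hμ => ?_, fun μ hμ => ?_⟩
  · exact infinite_approxSet (B := fun n => x (n + 1)) (fun n => (hpos n).1) hlow hupp hxmono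
      hloglim hratio hμ
  · exact finite_approxSet (B := fun n => x (n + 1)) (b := fun n => y (n + 1))
      (fun n => (hpos n).1) hlam2 (by nlinarith)
      (fun n => (hrec (n + 1) (by omega)).2) hymono hcopr hlow hupp hloglim hratio hμ
end
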